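/- arXiv:2311.00543 — 2 statements merged into one kernel-verified Lean document; each statement's English description precedes it below -/
import Mathlib

section
/- Deterministic tensor estimate (Lemma 3.12): Let k ≥ 3 be an integer and fix signs ε_sum, ε_1, …, ε_k ∈ {−1,+1}. Assume either k = 3, 1 < α ≤ 3/2 and ε = 0, or k > 3, 1 < α < 3/2 and ε > 0 is sufficiently small; let ε′ > 0 be arbitrarily small; and let s ∈ ℝ satisfy max(−α + 3/2, α − 1) < s < 2α − 3/2. Then there exist δ > 0 and C > 0, depending only on k, α, s, ε, ε′, such that the following holds for all ζ ∈ ℝ and all dyadic numbers N, N_1, …, N_k ≥ 1 with N_j ≤ N for every j. Define the tensor h^ζ on tuples (n, n_1, …, n_k) ∈ (ℤ³)^{k+1} by h^ζ_{n n_1 ⋯ n_k} = 1_{n = Σ_{j=1}^k n_j} · (Π_{j=1}^k 1_{|n_j| ∼ N_j} · 1_{|n_j| ≤ N}) · 1_{|κ(n_1,…,n_k) − ζ| ≤ 1} · ⟨n⟩^{s−α+ε′} / ( Π_{j=1}^{k−1} ⟪n_j⟫ · ⟨n_k⟩^{s} ). Then for every partition of {1,…,k−1} into disjoint sets B_1 and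 B_2, the operator norm ‖h^ζ‖ from ℓ² of the input variables (n_k, (n_j)_{j ∈ B_1}) to ℓ² of the output variables (n, (n_j)_{j ∈ B_2}) satisfies ‖h^ζ‖ ≤ C · N^{(k−3)(3/2−α) − ε} · (max{N_1, …, N_k})^{−δ}. -/
noncomputable section

open scoped BigOperators

/-- Japanese bracket of a real number: `⟨x⟩ = (1 + x²)^{1/2}`. -/
def rjb (x : ℝ) : ℝ := Real.sqrt (1 + x ^ 2)

/-- Euclidean norm of a lattice point in `ℤ³`. -/
def znorm (n : Fin 3 → ℤ) : ℝ := Real.sqrt (∑ i, ((n i : ℝ)) ^ 2)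

/-- Japanese bracket `⟨n⟩ = (1 + |n|²)^{1/2}` of a lattice point in `ℤ³`. -/
def jb (n : Fin 3 → ℤ) : ℝ := Real.sqrt (1 + ∑ i, ((n i : ℝ)) ^ 2)

/-- The modified bracket `⟪n⟫ = (⟨n⟩^{2α} − 1/4)^{1/2}`. -/
def jbb (α : ℝ) (n : Fin 3 → ℤ) : ℝ := Real.sqrt (jb n ^ (2 * α) - 1 / 4)

/-- Dyadic numbers `2^j`, `j ≥ 0`. -/
def IsDyadic (N : ℝ) : Prop := ∃ j : ℕ, N = 2 ^ j

/-- `|n| ∼ N` for a dyadic number `N`: `N/2 < |n| ≤ N` if `N ≥ 2`, and `|n| ≤ 1` if `N = 1`. -/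
def SimFreq (N : ℝ) (n : Fin 3 → ℤ) : Prop :=
  (2 ≤ N ∧ N / 2 < znorm n ∧ znorm n ≤ N) ∨ (N < 2 ∧ znorm n ≤ 1)

/-- `x` is a sign `±1`. -/
def IsSign (x : ℝ) : Prop := x = 1 ∨ x = -1

open Classical in
/-- Real-valued indicator of a proposition. -/
def ind (p : Prop) : ℝ := if p then 1 else 0

/-! ### Elementary facts on the brackets -/

lemma znorm_nonneg (n : Fin 3 → ℤ) : 0 ≤ znorm n := Real.sqrt_nonneg _

lemma znorm_sq (n : Fin 3 → ℤ) : znorm n ^ 2 = ∑ i, ((n i : ℝ)) ^ 2 :=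
  Real.sq_sqrt (Finset.sum_nonneg fun _ _ => sq_nonneg _)

lemma jb_sq (n : Fin 3 → ℤ) : jb n ^ 2 = 1 + znorm n ^ 2 := by
  rw [znorm_sq, jb, Real.sq_sqrt]
  have : 0 ≤ ∑ i, ((n i : ℝ)) ^ 2 := Finset.sum_nonneg fun _ _ => sq_nonneg _
  linarith

lemma jb_nonneg (n : Fin 3 → ℤ) : 0 ≤ jb n := Real.sqrt_nonneg _

lemma one_le_jb (n : Fin 3 → ℤ) : 1 ≤ jb n := by
  nlinarith [jb_sq n, jb_nonneg n, sq_nonneg (znorm n)]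

lemma jb_pos (n : Fin 3 → ℤ) : 0 < jb n := lt_of_lt_of_le one_pos (one_le_jb n)

lemma znorm_le_jb (n : Fin 3 → ℤ) : znorm n ≤ jb n :=
  abs_le_of_sq_le_sq' (by linarith [jb_sq n]) (jb_nonneg n) |>.2

lemma jb_le_one_add_znorm (n : Fin 3 → ℤ) : jb n ≤ 1 + znorm n := by
  have := znorm_nonneg n
  exact abs_le_of_sq_le_sq' (by nlinarith [jb_sq n]) (by linarith) |>.2

lemma one_add_znorm_le_two_mul_jb (n : Fin 3 → ℤ) : 1 + znorm n ≤ 2 * jb n := by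
  linarith [one_le_jb n, znorm_le_jb n]

lemma jb_neg (n : Fin 3 → ℤ) : jb (-n) = jb n := by simp [jb]

lemma jbb_neg (α : ℝ) (n : Fin 3 → ℤ) : jbb α (-n) = jbb α n := by simp [jbb, jb_neg]

lemma znorm_eq_norm (n : Fin 3 → ℤ) :
    znorm n = ‖(WithLp.toLp 2 (fun i => (n i : ℝ)) : EuclideanSpace ℝ (Fin 3))‖ := by
  simp [znorm, EuclideanSpace.norm_eq]

lemma znorm_add_le (a b : Fin 3 → ℤ) : znorm (a + b) ≤ znorm a + znorm b := by
  rw [znorm_eq_norm, znorm_eq_norm, znorm_eq_norm]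
  refine le_trans (le_of_eq ?_) (norm_add_le _ _)
  congr 1
  ext i
  simp

lemma one_le_znorm {n : Fin 3 → ℤ} (h : n ≠ 0) : 1 ≤ znorm n := by
  obtain ⟨i, hi⟩ := Function.ne_iff.mp h
  have h1 : (1 : ℝ) ≤ (n i : ℝ) ^ 2 := by
    have : 1 ≤ (n i) ^ 2 := by
      have := sq_pos_of_ne_zero hi
      exact this
    exact_mod_cast this
  have h2 : (n i : ℝ) ^ 2 ≤ ∑ i, ((n i : ℝ)) ^ 2 :=
    Finset.single_le_sum (f := fun i => (n i : ℝ) ^ 2) (fun _ _ => sq_nonneg _) (Finset.mem_univ i)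
  nlinarith [znorm_sq n, znorm_nonneg n]

lemma jb_rpow_eq (α : ℝ) (n : Fin 3 → ℤ) : jb n ^ (2 * α) = (1 + znorm n ^ 2) ^ α := by
  rw [Real.rpow_mul (jb_nonneg n), Real.rpow_two, jb_sq]

/-! ### Lattice points in the intersection of a spherical shell and a slab -/

lemma exists_orthogonal_coordinates (u : EuclideanSpace ℝ (Fin 3)) (hu : ‖u‖ = 1) :
    ∃ w : EuclideanSpace ℝ (Fin 3) →ₗ[ℝ] ℂ,
      ∀ x, ‖x‖ ^ 2 = (inner ℝ u x) ^ 2 + ‖w x‖ ^ 2 := by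
  obtain ⟨b, hb⟩ := Orthonormal.exists_orthonormalBasis_extension_of_card_eq
    (𝕜 := ℝ) (E := EuclideanSpace ℝ (Fin 3)) (ι := Fin 3) (by simp) (v := fun _ => u)
    (s := {0}) (by
      constructor
      · intro i; simpa using hu
      · intro i j hij
        exact absurd (Subsingleton.elim i j) hij)
  have hb0 : b 0 = u := hb 0 rfl
  refine ⟨{ toFun := fun x => ⟨inner ℝ (b 1) x, inner ℝ (b 2) x⟩
            map_add' := fun x y => by
              apply Complex.ext <;> simp [inner_add_right]
            map_smul' := fun c x => by
              apply Complex.ext <;> simp [inner_smul_right] }, fun x => ?_⟩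
  have h := b.sum_sq_norm_inner_right x
  rw [Fin.sum_univ_three, hb0] at h
  simp only [LinearMap.coe_mk, AddHom.coe_mk, Complex.sq_norm, Complex.normSq_mk]
  simp only [Real.norm_eq_abs, sq_abs] at h
  linarith

open MeasureTheory in
lemma volume_annulus_le (A B : ℝ) (hAB : A ≤ B) :
    volume {w : ℂ | A ≤ ‖w‖ ^ 2 ∧ ‖w‖ ^ 2 ≤ B} ≤ ENNReal.ofReal (Real.pi * (B - A)) := by
  rcases lt_or_ge B 0 with hB | hB
  · have : {w : ℂ | A ≤ ‖w‖ ^ 2 ∧ ‖w‖ ^ 2 ≤ B} = ∅ := by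
      ext w
      simp only [Set.mem_ofPred_eq, Set.mem_empty_iff_false, iff_false, not_and, not_le]
      intro _
      exact lt_of_lt_of_le hB (sq_nonneg _)
    simp [this]
  have hvol : ∀ r : ℝ, 0 ≤ r → volume (Metric.closedBall (0 : ℂ) r) =
      ENNReal.ofReal (Real.pi * r ^ 2) := by
    intro r hr
    rw [Complex.volume_closedBall, mul_comm Real.pi, ENNReal.ofReal_mul (sq_nonneg r),
      ENNReal.ofReal_pow hr]
    congr 1
    rw [← NNReal.coe_real_pi, ENNReal.ofReal_coe_nnreal]
  have hvol' : ∀ r : ℝ, 0 ≤ r → volume (Metric.ball (0 : ℂ) r) =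
      ENNReal.ofReal (Real.pi * r ^ 2) := by
    intro r hr
    rw [Complex.volume_ball, mul_comm Real.pi, ENNReal.ofReal_mul (sq_nonneg r),
      ENNReal.ofReal_pow hr]
    congr 1
    rw [← NNReal.coe_real_pi, ENNReal.ofReal_coe_nnreal]
  have hsub : {w : ℂ | A ≤ ‖w‖ ^ 2 ∧ ‖w‖ ^ 2 ≤ B} ⊆
      Metric.closedBall 0 (√B) \ Metric.ball 0 (√A) := by
    rintro w ⟨h1, h2⟩
    simp only [Set.mem_sdiff, Metric.mem_closedBall, dist_zero_right, Metric.mem_ball, not_lt]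
    exact ⟨Real.le_sqrt_of_sq_le h2, Real.sqrt_le_iff.mpr ⟨norm_nonneg _, h1⟩⟩
  refine (measure_mono hsub).trans ?_
  rw [measure_sdiff ((Metric.ball_subset_ball (Real.sqrt_le_sqrt hAB)).trans
    Metric.ball_subset_closedBall) measurableSet_ball.nullMeasurableSet
    (by rw [hvol' _ (Real.sqrt_nonneg _)]; exact ENNReal.ofReal_ne_top),
    hvol _ (Real.sqrt_nonneg _), hvol' _ (Real.sqrt_nonneg _), Real.sq_sqrt hB,
    ← ENNReal.ofReal_sub _ (by positivity)]
  apply ENNReal.ofReal_le_ofReal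
  have : A ≤ √A ^ 2 := by
    rcases le_total 0 A with h | h
    · rw [Real.sq_sqrt h]
    · exact h.trans (sq_nonneg _)
  nlinarith [Real.pi_pos]

open MeasureTheory in
lemma volume_slab_shell_le (A B t t' : ℝ) (hAB : A ≤ B) :
    volume {z : ℝ × ℂ | z.1 ∈ Set.Icc t t' ∧ A ≤ z.1 ^ 2 + ‖z.2‖ ^ 2 ∧ z.1 ^ 2 + ‖z.2‖ ^ 2 ≤ B} ≤
      ENNReal.ofReal (Real.pi * (B - A)) * ENNReal.ofReal (t' - t) := by
  set S := {z : ℝ × ℂ | z.1 ∈ Set.Icc t t' ∧ A ≤ z.1 ^ 2 + ‖z.2‖ ^ 2 ∧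
    z.1 ^ 2 + ‖z.2‖ ^ 2 ≤ B} with hS
  have hmeas : MeasurableSet S := by
    apply IsClosed.measurableSet
    have hc : Continuous fun z : ℝ × ℂ => z.1 ^ 2 + ‖z.2‖ ^ 2 := by fun_prop
    exact (isClosed_Icc.preimage continuous_fst).inter
      ((isClosed_le continuous_const hc).inter (isClosed_le hc continuous_const))
  rw [Measure.volume_eq_prod, Measure.prod_apply hmeas]
  calc ∫⁻ x, volume (Prod.mk x ⁻¹' S)
      ≤ ∫⁻ x, (Set.Icc t t').indicator (fun _ => ENNReal.ofReal (Real.pi * (B - A))) x := by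
        refine lintegral_mono fun x => ?_
        by_cases hx : x ∈ Set.Icc t t'
        · rw [Set.indicator_of_mem hx]
          have hle := volume_annulus_le (A - x ^ 2) (B - x ^ 2) (by linarith)
          rw [sub_sub_sub_cancel_right] at hle
          refine le_trans (measure_mono ?_) hle
          rintro w ⟨-, h1, h2⟩
          simp only at h1 h2
          exact ⟨by linarith, by linarith⟩
        · have : Prod.mk x ⁻¹' S = ∅ := by
            ext w
            simp only [hS, Set.mem_preimage, Set.mem_ofPred_eq, Set.mem_empty_iff_false, iff_false]
            exact fun h => hx h.1
          simp [this]
    _ = _ := by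
        rw [lintegral_indicator measurableSet_Icc, setLIntegral_const, Real.volume_Icc]

open MeasureTheory in
set_option maxHeartbeats 800000 in
/-- Lattice points in a unit spherical shell of radius `ρ` and a slab of thickness `T`. -/
lemma card_slab_shell_le (S : Finset (Fin 3 → ℤ)) (u : EuclideanSpace ℝ (Fin 3)) (hu : ‖u‖ = 1)
    (ρ t T : ℝ) (hρ : 0 ≤ ρ) (hT : 0 ≤ T)
    (hS : ∀ n ∈ S, ρ ≤ znorm n ∧ znorm n ≤ ρ + 1 ∧
      t ≤ ∑ i, u i * (n i : ℝ) ∧ ∑ i, u i * (n i : ℝ) ≤ t + T) :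
    (S.card : ℝ) ≤ 300 * (1 + ρ) * (1 + T) := by
  obtain ⟨w, hw⟩ := exists_orthogonal_coordinates u hu
  let e : (Fin 3 → ℤ) → EuclideanSpace ℝ (Fin 3) := fun n => WithLp.toLp 2 (fun i => (n i : ℝ))
  have he : ∀ n, inner ℝ u (e n) = ∑ i, u i * (n i : ℝ) := by
    intro n
    simp [e, PiLp.inner_apply, mul_comm]
  have hes : ∀ n n', e n - e n' = e (n - n') := by
    intro n n'; ext i; simp [e]
  let z : (Fin 3 → ℤ) → ℝ × ℂ := fun n => (inner ℝ u (e n), w (e n))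
  set A := ρ ^ 2 - 2 * (ρ + 2) with hA
  set B := (ρ + 1) ^ 2 + 2 * (ρ + 2) with hB
  have hdisj : (S : Set (Fin 3 → ℤ)).PairwiseDisjoint (fun n => Metric.ball (z n) (1 / 3)) := by
    intro n _ n' _ hne
    rw [Function.onFun, Set.disjoint_left]
    intro y hy hy'
    have h1 : dist (z n) (z n') < 2 / 3 := by
      have := dist_triangle_left (z n) (z n') y
      rw [Metric.mem_ball] at hy hy'
      linarith
    have h2 := max_lt_iff.mp (Prod.dist_eq (x := z n) (y := z n') ▸ h1)
    have h3 := hw (e n - e n')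
    rw [map_sub, inner_sub_right] at h3
    have h4 : 1 ≤ ‖e n - e n'‖ := by
      rw [hes, ← znorm_eq_norm]
      exact one_le_znorm (sub_ne_zero.mpr hne)
    obtain ⟨h5, h6⟩ := h2
    rw [Real.dist_eq] at h5
    rw [dist_eq_norm] at h6
    simp only [z] at h5 h6
    have h7 := abs_lt.mp h5
    nlinarith [norm_nonneg (w (e n) - w (e n'))]
  have hsub : (⋃ n ∈ S, Metric.ball (z n) (1 / 3)) ⊆ {z : ℝ × ℂ | z.1 ∈ Set.Icc (t - 1) (t + T + 1) ∧
      A ≤ z.1 ^ 2 + ‖z.2‖ ^ 2 ∧ z.1 ^ 2 + ‖z.2‖ ^ 2 ≤ B} := by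
    intro y hy
    simp only [Set.mem_iUnion, exists_prop] at hy
    obtain ⟨n, hn, hy⟩ := hy
    obtain ⟨h1, h2, h3, h4⟩ := hS n hn
    rw [Metric.mem_ball, Prod.dist_eq, max_lt_iff, Real.dist_eq, dist_eq_norm] at hy
    obtain ⟨hy1, hy2⟩ := hy
    have h5 := hw (e n)
    rw [← znorm_eq_norm] at h5
    rw [← he] at h3 h4
    simp only [z] at hy1 hy2
    set a := inner ℝ u (e n)
    have hy1' := abs_lt.mp hy1
    have h6 := abs_le.mp ((abs_norm_sub_norm_le y.2 (w (e n))).trans hy2.le)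
    set b := ‖w (e n)‖
    have hb : 0 ≤ b := norm_nonneg _
    have hb' : 0 ≤ ‖y.2‖ := norm_nonneg _
    have hbz : b ≤ ρ + 1 := by nlinarith [sq_nonneg a, znorm_nonneg n]
    have haz : |a| ≤ ρ + 1 := by
      apply abs_le_of_sq_le_sq _ (by linarith)
      nlinarith [sq_nonneg b, znorm_nonneg n]
    have haz' := abs_le.mp haz
    have hz1 : ρ ^ 2 ≤ a ^ 2 + b ^ 2 := by rw [← h5]; gcongr
    have hz2 : a ^ 2 + b ^ 2 ≤ (ρ + 1) ^ 2 := by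
      rw [← h5]; exact pow_le_pow_left₀ (znorm_nonneg n) h2 2
    obtain ⟨d, hd⟩ : ∃ d, y.1 = a + d := ⟨y.1 - a, by ring⟩
    obtain ⟨d', hd'⟩ : ∃ d', ‖y.2‖ = b + d' := ⟨‖y.2‖ - b, by ring⟩
    have hd1 : |d| ≤ 1 / 3 := by rw [abs_le]; constructor <;> linarith
    have hd2 : |d'| ≤ 1 / 3 := by rw [abs_le]; constructor <;> linarith
    have had : |a * d| ≤ (ρ + 1) * (1 / 3) := by
      rw [abs_mul]; exact mul_le_mul haz hd1 (abs_nonneg _) (by linarith)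
    have hbd : |b * d'| ≤ (ρ + 1) * (1 / 3) := by
      rw [abs_mul, abs_of_nonneg hb]; exact mul_le_mul hbz hd2 (abs_nonneg _) (by linarith)
    have hdd : d ^ 2 ≤ 1 / 9 := by
      rw [← sq_abs]; nlinarith [abs_nonneg d]
    have hdd' : d' ^ 2 ≤ 1 / 9 := by
      rw [← sq_abs]; nlinarith [abs_nonneg d']
    have had' := abs_le.mp had
    have hbd' := abs_le.mp hbd
    refine ⟨⟨by linarith, by linarith⟩, ?_, ?_⟩
    · rw [hd, hd', hA]
      linarith only [sq_nonneg d, sq_nonneg d', hz1, had'.1, hbd'.1, hρ, add_sq a d, add_sq b d']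
    · rw [hd, hd', hB]
      linarith only [hdd, hdd', hz2, had'.2, hbd'.2, hρ, add_sq a d, add_sq b d']
  have hball : ∀ n, volume (Metric.ball (z n) (1 / 3)) = ENNReal.ofReal (2 / 27 * Real.pi) := by
    intro n
    rw [← ball_prod_same, Measure.volume_eq_prod, Measure.prod_prod, Real.volume_ball,
      Complex.volume_ball, ← ENNReal.ofReal_pow (by norm_num), ← ENNReal.ofReal_coe_nnreal,
      NNReal.coe_real_pi, ← ENNReal.ofReal_mul (by norm_num), ← ENNReal.ofReal_mul (by norm_num)]
    congr 1
    ring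
  have hmain := (measure_mono hsub).trans (volume_slab_shell_le A B (t - 1) (t + T + 1)
    (by rw [hA, hB]; nlinarith))
  rw [measure_biUnion_finset hdisj (fun _ _ => measurableSet_ball)] at hmain
  simp only [hball, Finset.sum_const, nsmul_eq_mul] at hmain
  rw [← ENNReal.ofReal_natCast, ← ENNReal.ofReal_mul (by positivity),
    ← ENNReal.ofReal_mul (by rw [hA, hB]; have := Real.pi_pos; apply mul_nonneg this.le; nlinarith),
    ENNReal.ofReal_le_ofReal_iff (by
      rw [hA, hB]; have := Real.pi_pos
      apply mul_nonneg (mul_nonneg this.le (by nlinarith)) (by linarith))] at hmain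
  have hBA : B - A = 6 * ρ + 9 := by rw [hA, hB]; ring
  rw [hBA] at hmain
  have h8 : (S.card : ℝ) * (2 / 27) ≤ (6 * ρ + 9) * (T + 2) := by
    refine le_of_mul_le_mul_right ?_ Real.pi_pos
    linarith
  nlinarith [mul_nonneg hρ hT]

/-! ### Variation of the dispersion relation -/

/-- The dispersion relation as a function of the Euclidean norm. -/
def disp (α v : ℝ) : ℝ := Real.sqrt ((1 + v ^ 2) ^ α - 1 / 4)

lemma jbb_eq_disp (α : ℝ) (n : Fin 3 → ℤ) : jbb α n = disp α (znorm n) := by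
  rw [jbb, jb_rpow_eq, disp]

lemma one_le_one_add_sq_rpow {α : ℝ} (hα : 0 ≤ α) (v : ℝ) : 1 ≤ (1 + v ^ 2) ^ α :=
  Real.one_le_rpow (by nlinarith [sq_nonneg v]) hα

lemma disp_sq {α : ℝ} (hα : 0 ≤ α) (v : ℝ) : disp α v ^ 2 = (1 + v ^ 2) ^ α - 1 / 4 :=
  Real.sq_sqrt (by linarith [one_le_one_add_sq_rpow hα v])

lemma disp_nonneg (α v : ℝ) : 0 ≤ disp α v := Real.sqrt_nonneg _

lemma rpow_eq_sq_rpow_half {α X : ℝ} (hX : 0 < X) :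
    X ^ (α - 1) = (X ^ ((α - 1) / 2)) ^ 2 ∧ X ^ α = (X ^ ((α - 1) / 2)) ^ 2 * X := by
  have h : X ^ (α - 1) = (X ^ ((α - 1) / 2)) ^ 2 := by
    rw [← Real.rpow_natCast, ← Real.rpow_mul hX.le]
    congr 1
    push_cast
    ring
  refine ⟨h, ?_⟩
  rw [← h, ← Real.rpow_add_one hX.ne']
  congr 1
  ring

lemma disp_mono {α v v' : ℝ} (hα : 0 ≤ α) (hv : 0 ≤ v) (hvv' : v ≤ v') :
    disp α v ≤ disp α v' := by
  apply Real.sqrt_le_sqrt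
  have : (1 + v ^ 2) ^ α ≤ (1 + v' ^ 2) ^ α := by gcongr
  linarith

lemma le_disp_sub_disp {α ρ v v' : ℝ} (hα : 1 ≤ α) (hρ : 0 ≤ ρ) (hρv : ρ ≤ v) (hvv' : v ≤ v')
    (hv' : 1 ≤ v') :
    (1 + ρ ^ 2) ^ ((α - 1) / 2) * (v' - v) ≤ 4 * (disp α v' - disp α v) := by
  have hv : 0 ≤ v := hρ.trans hρv
  set X := 1 + v ^ 2 with hX
  set X' := 1 + v' ^ 2 with hX'
  have hX0 : 0 < X := by positivity
  have hX'0 : 0 < X' := by positivity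
  have hXX' : X ≤ X' := by rw [hX, hX']; gcongr
  set G := X' ^ ((α - 1) / 2) with hG
  have hG0 : 0 < G := Real.rpow_pos_of_pos hX'0 _
  obtain ⟨e1, e2⟩ := rpow_eq_sq_rpow_half (α := α) hX'0
  have e3 : X ^ α ≤ G ^ 2 * X := by
    rw [← e1, show X ^ α = X ^ (α - 1) * X by rw [← Real.rpow_add_one hX0.ne']; congr 1; ring]
    gcongr
  have s1 := disp_sq (α := α) (by linarith) v
  have s2 := disp_sq (α := α) (by linarith) v'
  rw [← hX] at s1
  rw [← hX', e2, ← hG] at s2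
  have hD := disp_mono (α := α) (by linarith) hv hvv'
  have h0 := disp_nonneg α v
  have hX'v : X' ≤ (2 * v') ^ 2 := by nlinarith
  have hup : disp α v' ≤ G * (2 * v') := by
    apply abs_le_of_sq_le_sq' _ (by positivity) |>.2
    rw [mul_pow]
    nlinarith [mul_le_mul_of_nonneg_left hX'v (sq_nonneg G)]
  have hprod : G ^ 2 * ((v' - v) * v') ≤ (disp α v' - disp α v) * (2 * (G * (2 * v'))) := by
    calc G ^ 2 * ((v' - v) * v') ≤ G ^ 2 * (X' - X) := by
          apply mul_le_mul_of_nonneg_left _ (sq_nonneg G)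
          rw [hX, hX']
          nlinarith [mul_nonneg (sub_nonneg.mpr hvv') hv]
      _ ≤ (disp α v' - disp α v) * (disp α v' + disp α v) := by nlinarith
      _ ≤ _ := by
          apply mul_le_mul_of_nonneg_left _ (by linarith)
          linarith
  have hcancel : G * (v' - v) ≤ 4 * (disp α v' - disp α v) := by
    have hp : 0 < G * v' := by positivity
    refine le_of_mul_le_mul_right ?_ hp
    linarith
  refine le_trans ?_ hcancel
  apply mul_le_mul_of_nonneg_right _ (by linarith)
  rw [hG, hX']
  apply Real.rpow_le_rpow (by positivity) _ (by linarith)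
  nlinarith

lemma disp_sub_disp_le {α ρ u u' : ℝ} (hα : 1 ≤ α) (hα' : α ≤ 3 / 2) (hρ : 0 ≤ ρ) (hρu : ρ ≤ u)
    (huu' : u ≤ u') (hu' : u' ≤ ρ + 1) :
    disp α u' - disp α u ≤ 24 * (1 + ρ ^ 2) ^ ((α - 1) / 2) := by
  have hu : 0 ≤ u := hρ.trans hρu
  set X := 1 + u ^ 2 with hX
  set X' := 1 + u' ^ 2 with hX'
  have hX0 : 0 < X := by positivity
  have hX'0 : 0 < X' := by positivity
  have hXX' : X ≤ X' := by rw [hX, hX']; gcongr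
  set G := X' ^ ((α - 1) / 2) with hG
  have hG0 : 0 < G := Real.rpow_pos_of_pos hX'0 _
  obtain ⟨e1, e2⟩ := rpow_eq_sq_rpow_half (α := α) hX'0
  have e3 : G ^ 2 * X ^ 2 ≤ X ^ α * X' := by
    have h1 : X' ^ (α - 2) ≤ X ^ (α - 2) :=
      Real.rpow_le_rpow_of_nonpos hX0 hXX' (by linarith)
    have h2 : X ^ α = X ^ (α - 2) * X ^ 2 := by
      rw [← Real.rpow_natCast X 2, ← Real.rpow_add hX0]; congr 1; push_cast; ring
    have h3 : G ^ 2 = X' ^ (α - 2) * X' := by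
      rw [hG, ← e1, ← Real.rpow_add_one hX'0.ne']; congr 1; ring
    rw [h2, h3]
    nlinarith [mul_le_mul_of_nonneg_right h1 (mul_nonneg (sq_nonneg X) hX'0.le)]
  have e4 : G ^ 2 * X' - X ^ α ≤ 2 * G ^ 2 * (X' - X) := by
    refine le_of_mul_le_mul_right ?_ hX'0
    nlinarith [mul_nonneg (sq_nonneg G) (sq_nonneg (X' - X))]
  have s1 := disp_sq (α := α) (by linarith) u
  have s2 := disp_sq (α := α) (by linarith) u'
  rw [← hX] at s1
  have s3 := one_le_one_add_sq_rpow (α := α) (by linarith) u'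
  rw [← hX', e2, ← hG] at s2 s3
  have hD := disp_mono (α := α) (by linarith) hu huu'
  have h0 := disp_nonneg α u
  set r := √X' with hr
  have hr0 : 0 < r := Real.sqrt_pos.mpr hX'0
  have hrsq : r ^ 2 = X' := Real.sq_sqrt hX'0.le
  have hur : u' ≤ r := Real.le_sqrt_of_sq_le (by rw [hX']; linarith)
  have hlow : G * r ≤ 2 * disp α u' := by
    apply abs_le_of_sq_le_sq' _ (by linarith) |>.2
    rw [mul_pow, mul_pow, hrsq]
    nlinarith
  have hprod : (disp α u' - disp α u) * (G * r) ≤ 8 * G * (G * r) := by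
    calc (disp α u' - disp α u) * (G * r)
        ≤ (disp α u' - disp α u) * (2 * disp α u') :=
          mul_le_mul_of_nonneg_left hlow (by linarith)
      _ ≤ 2 * ((disp α u' - disp α u) * (disp α u' + disp α u)) := by nlinarith
      _ ≤ 2 * (2 * G ^ 2 * (X' - X)) := by nlinarith
      _ ≤ 2 * (2 * G ^ 2 * (2 * r)) := by
          gcongr
          rw [hX, hX']
          nlinarith
      _ = _ := by ring
  have h1 : disp α u' - disp α u ≤ 8 * G := le_of_mul_le_mul_right hprod (by positivity)
  have h2 : G ≤ 3 * (1 + ρ ^ 2) ^ ((α - 1) / 2) := by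
    calc G ≤ (3 * (1 + ρ ^ 2)) ^ ((α - 1) / 2) := by
          apply Real.rpow_le_rpow hX'0.le _ (by linarith)
          rw [hX']
          nlinarith [sq_nonneg (ρ - 1)]
      _ = 3 ^ ((α - 1) / 2) * (1 + ρ ^ 2) ^ ((α - 1) / 2) :=
          Real.mul_rpow (by norm_num) (by positivity)
      _ ≤ 3 ^ (1 : ℝ) * (1 + ρ ^ 2) ^ ((α - 1) / 2) := by
          gcongr
          · norm_num
          · linarith
      _ = _ := by rw [Real.rpow_one]
  linarith

lemma norm_gap_le {α ρ u u' v v' : ℝ} (hα : 1 ≤ α) (hα' : α ≤ 3 / 2) (hρ : 0 ≤ ρ)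
    (hu : ρ ≤ u) (hu1 : u ≤ ρ + 1) (hu' : ρ ≤ u') (hu'1 : u' ≤ ρ + 1) (hv : ρ ≤ v) (hv' : ρ ≤ v')
    (h : |disp α v' - disp α v| ≤ 2 + |disp α u' - disp α u|) : |v' - v| ≤ 104 := by
  wlog hvv' : v ≤ v' generalizing v v' u u'
  · rw [abs_sub_comm]
    exact this hu' hu'1 hu hu1 hv' hv (by
      rw [abs_sub_comm, abs_sub_comm (disp α u)]; exact h) (by linarith)
  wlog huu' : u ≤ u' generalizing u u'
  · exact this hu' hu'1 hu hu1 (by rw [abs_sub_comm (disp α u)]; exact h) (by linarith)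
  rw [abs_of_nonneg (by linarith)]
  rcases le_total v' 1 with h1 | h1
  · linarith
  have a1 := le_disp_sub_disp hα hρ hv hvv' h1
  have a2 := disp_sub_disp_le hα hα' hρ hu huu' hu'1
  have hG := one_le_one_add_sq_rpow (α := (α - 1) / 2) (by linarith) ρ
  rw [abs_of_nonneg (sub_nonneg.mpr (disp_mono (by linarith) (hρ.trans hv) hvv')),
    abs_of_nonneg (sub_nonneg.mpr (disp_mono (by linarith) (hρ.trans hu) huu'))] at h
  refine le_of_mul_le_mul_left ?_ (lt_of_lt_of_le one_pos hG)
  linarith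

/-! ### Counting lattice points on a unit shell -/

lemma inner_toLp_intCast (a n : Fin 3 → ℤ) :
    2 * ∑ i, (a i : ℝ) * (n i : ℝ) = znorm (n + a) ^ 2 - znorm n ^ 2 - znorm a ^ 2 := by
  simp only [znorm_sq, Fin.sum_univ_three, Pi.add_apply, Int.cast_add]
  ring

lemma abs_coord_le_znorm (n : Fin 3 → ℤ) (i : Fin 3) : |(n i : ℝ)| ≤ znorm n := by
  apply abs_le_of_sq_le_sq _ (znorm_nonneg n)
  rw [znorm_sq]
  exact Finset.single_le_sum (f := fun i => (n i : ℝ) ^ 2) (fun _ _ => sq_nonneg _)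
    (Finset.mem_univ i)

lemma card_shell_le (S : Finset (Fin 3 → ℤ)) (ρ : ℝ) (hρ : 0 ≤ ρ)
    (hS : ∀ n ∈ S, ρ ≤ znorm n ∧ znorm n ≤ ρ + 1) : (S.card : ℝ) ≤ 900 * (1 + ρ) ^ 2 := by
  have h := card_slab_shell_le S (EuclideanSpace.single 0 1) (by simp) ρ (-(ρ + 1)) (2 * (ρ + 1))
    hρ (by linarith) (fun n hn => by
      obtain ⟨h1, h2⟩ := hS n hn
      have h3 := abs_le.mp ((abs_coord_le_znorm n 0).trans h2)
      have h4 : ∑ i, (EuclideanSpace.single (0 : Fin 3) (1 : ℝ)) i * (n i : ℝ) = n 0 := by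
        simp
      rw [h4]
      exact ⟨h1, h2, h3.1, by linarith [h3.2]⟩)
  nlinarith

lemma IsSign.abs_mul_eq {x : ℝ} (hx : IsSign x) (y : ℝ) : |x * y| = |y| := by
  rcases hx with rfl | rfl <;> simp

lemma card_shell_phase_le {α : ℝ} (hα : 1 ≤ α) (hα' : α ≤ 3 / 2) {σ τ : ℝ} (hσ : IsSign σ)
    (hτ : IsSign τ) (a : Fin 3 → ℤ) (c : ℝ) (S : Finset (Fin 3 → ℤ)) (ρ : ℝ) (hρ : 0 ≤ ρ)
    (hS : ∀ n ∈ S, ρ ≤ znorm n ∧ znorm n ≤ ρ + 1 ∧ znorm n ≤ znorm (n + a) ∧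
      |σ * jbb α (n + a) + τ * jbb α n - c| ≤ 1) :
    (S.card : ℝ) ≤ 130000 * (1 + ρ) * (1 + (1 + ρ) / jb a) := by
  have hja := jb_pos a
  rcases S.eq_empty_or_nonempty with rfl | ⟨n₀, hn₀⟩
  · simp only [Finset.card_empty, Nat.cast_zero]; positivity
  by_cases ha : a = 0
  · have h := card_shell_le S ρ hρ (fun n hn => ⟨(hS n hn).1, (hS n hn).2.1⟩)
    have h1 : jb a = 1 := by subst ha; simp [jb]
    rw [h1]
    nlinarith
  have ha1 := one_le_znorm ha
  set A := znorm a with hA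
  have hA0 : 0 < A := by linarith
  obtain ⟨g1, g2, g3, g4⟩ := hS n₀ hn₀
  set u : EuclideanSpace ℝ (Fin 3) := A⁻¹ • WithLp.toLp 2 (fun i => (a i : ℝ)) with hu
  have hunorm : ‖u‖ = 1 := by
    rw [hu, norm_smul, ← znorm_eq_norm, ← hA, Real.norm_eq_abs, abs_of_pos (by positivity)]
    field_simp
  have hui : ∀ n : Fin 3 → ℤ, ∑ i, u i * (n i : ℝ) =
      (znorm (n + a) ^ 2 - znorm n ^ 2 - A ^ 2) / (2 * A) := by
    intro n
    have h := inner_toLp_intCast a n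
    rw [eq_div_iff (by positivity), hA, ← h]
    simp only [hu, PiLp.smul_apply, smul_eq_mul, Fin.sum_univ_three]
    field_simp
    rw [← hA, mul_comm]
  set T := 210 * (1 + (1 + ρ) / A) with hT
  have hkey : ∀ n ∈ S, |∑ i, u i * (n i : ℝ) - ∑ i, u i * (n₀ i : ℝ)| ≤ T / 2 := by
    intro n hn
    obtain ⟨h1, h2, h3, h4⟩ := hS n hn
    have hgap : |znorm (n + a) - znorm (n₀ + a)| ≤ 104 := by
      refine norm_gap_le hα hα' hρ g1 g2 h1 h2 (g1.trans g3) (h1.trans h3) ?_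
      rw [← jbb_eq_disp, ← jbb_eq_disp, ← jbb_eq_disp, ← jbb_eq_disp,
        ← hσ.abs_mul_eq (jbb α (n + a) - jbb α (n₀ + a)), ← hτ.abs_mul_eq (jbb α n - jbb α n₀)]
      have e : σ * (jbb α (n + a) - jbb α (n₀ + a)) =
          ((σ * jbb α (n + a) + τ * jbb α n - c) - (σ * jbb α (n₀ + a) + τ * jbb α n₀ - c)) -
            τ * (jbb α n - jbb α n₀) := by ring
      rw [e]
      refine (abs_sub _ _).trans (add_le_add ?_ le_rfl)
      refine (abs_sub _ _).trans ?_
      linarith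
    have b1 : znorm (n + a) ≤ ρ + 1 + A := (znorm_add_le n a).trans (by linarith)
    have b2 : znorm (n₀ + a) ≤ ρ + 1 + A := (znorm_add_le n₀ a).trans (by linarith)
    have q1 : |znorm (n + a) ^ 2 - znorm (n₀ + a) ^ 2| ≤ 104 * (2 * (ρ + 1 + A)) := by
      rw [sq_sub_sq, abs_mul, mul_comm]
      refine mul_le_mul hgap ?_ (abs_nonneg _) (by norm_num)
      rw [abs_of_nonneg (add_nonneg (znorm_nonneg _) (znorm_nonneg _))]
      linarith
    have q2 : |znorm n ^ 2 - znorm n₀ ^ 2| ≤ 1 * (2 * (ρ + 1)) := by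
      rw [sq_sub_sq, abs_mul, mul_comm]
      refine mul_le_mul (abs_le.mpr ⟨by linarith, by linarith⟩) ?_ (abs_nonneg _) (by norm_num)
      rw [abs_of_nonneg (add_nonneg (znorm_nonneg _) (znorm_nonneg _))]
      linarith
    rw [hui, hui, ← sub_div, abs_div, abs_of_pos (show 0 < 2 * A by positivity),
      div_le_iff₀ (by positivity)]
    have e : T / 2 * (2 * A) = 210 * (A + (1 + ρ)) := by
      rw [hT]; field_simp
    rw [e]
    have q1' := abs_le.mp q1
    have q2' := abs_le.mp q2
    rw [abs_le]
    constructor <;> linarith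
  have hT0 : 0 ≤ T := by positivity
  have h := card_slab_shell_le S u hunorm ρ (∑ i, u i * (n₀ i : ℝ) - T / 2) T hρ hT0
    (fun n hn => by
      have h3 := abs_le.mp (hkey n hn)
      exact ⟨(hS n hn).1, (hS n hn).2.1, by linarith [h3.1], by linarith [h3.2]⟩)
  have hdiv : (1 + ρ) / A ≤ 2 * ((1 + ρ) / jb a) := by
    rw [← mul_div_assoc, div_le_div_iff₀ hA0 hja]
    nlinarith [jb_le_one_add_znorm a]
  have hq : 0 ≤ (1 + ρ) / jb a := by positivity
  calc (S.card : ℝ) ≤ 300 * (1 + ρ) * (1 + T) := h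
    _ ≤ 300 * (1 + ρ) * (421 * (1 + (1 + ρ) / jb a)) := by
        gcongr
        rw [hT]
        linarith
    _ ≤ _ := by
        have : 0 ≤ (1 + ρ) * (1 + (1 + ρ) / jb a) := by positivity
        nlinarith

/-! ### Weighted sums over balls -/

lemma jb_rpow_neg_le {γ k : ℝ} (hγ : 0 ≤ γ) (hγ1 : γ ≤ 1) (hk : 0 ≤ k) {n : Fin 3 → ℤ}
    (hn : k ≤ znorm n) : jb n ^ (-γ) ≤ 2 * (1 + k) ^ (-γ) := by
  have h1 : (1 + k) / 2 ≤ jb n := by linarith [one_add_znorm_le_two_mul_jb n]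
  calc jb n ^ (-γ) ≤ ((1 + k) / 2) ^ (-γ) :=
        Real.rpow_le_rpow_of_nonpos (by linarith) h1 (by linarith)
    _ = 2 ^ γ * (1 + k) ^ (-γ) := by
        rw [Real.div_rpow (by linarith) (by norm_num), Real.rpow_neg (by norm_num : (0:ℝ) ≤ 2),
          div_inv_eq_mul, mul_comm]
    _ ≤ 2 ^ (1 : ℝ) * (1 + k) ^ (-γ) := by
        gcongr
        norm_num
    _ = _ := by rw [Real.rpow_one]

/-- A weighted sum over a ball, from counting bounds on the unit shells of
`min |p| |p + a|`. -/
lemma weighted_sum_le {γ : ℝ} (hγ : 0 ≤ γ) (hγ1 : γ ≤ 1) (a : Fin 3 → ℤ)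
    (S : Finset (Fin 3 → ℤ)) {R E : ℝ} (hR : 1 ≤ R) (hE : 0 ≤ E) (hS : ∀ p ∈ S, znorm p ≤ R)
    (h₁ : ∀ k : ℕ, (k : ℝ) ≤ R → ∀ S' ⊆ S, (∀ p ∈ S', (k : ℝ) ≤ znorm p ∧ znorm p ≤ k + 1 ∧
      znorm p ≤ znorm (p + a)) → (S'.card : ℝ) ≤ (1 + k) * E)
    (h₂ : ∀ k : ℕ, (k : ℝ) ≤ R → ∀ S' ⊆ S, (∀ p ∈ S', (k : ℝ) ≤ znorm (p + a) ∧
      znorm (p + a) ≤ k + 1 ∧ znorm (p + a) ≤ znorm p) → (S'.card : ℝ) ≤ (1 + k) * E) :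
    ∑ p ∈ S, jb (p + a) ^ (-γ) ≤ 16 * R ^ (2 - γ) * E := by
  classical
  set μ : (Fin 3 → ℤ) → ℝ := fun p => min (znorm p) (znorm (p + a)) with hμ
  have hμ0 : ∀ p, 0 ≤ μ p := fun p => le_min (znorm_nonneg _) (znorm_nonneg _)
  have hmaps : ∀ p ∈ S, ⌊μ p⌋₊ ∈ Finset.range (⌊R⌋₊ + 1) := by
    intro p hp
    rw [Finset.mem_range, Nat.lt_succ_iff]
    exact Nat.floor_le_floor ((min_le_left _ _).trans (hS p hp))
  rw [← Finset.sum_fiberwise_of_maps_to hmaps]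
  have hfib : ∀ k ∈ Finset.range (⌊R⌋₊ + 1),
      ∑ p ∈ S with ⌊μ p⌋₊ = k, jb (p + a) ^ (-γ) ≤ 8 * R ^ (1 - γ) * E := by
    intro k hk
    rw [Finset.mem_range, Nat.lt_succ_iff, Nat.le_floor_iff (by linarith)] at hk
    set F := S.filter (fun p => ⌊μ p⌋₊ = k) with hF
    have hFμ : ∀ p ∈ F, (k : ℝ) ≤ μ p ∧ μ p ≤ k + 1 := by
      intro p hp
      have h := (Finset.mem_filter.mp hp).2
      exact ⟨h ▸ Nat.floor_le (hμ0 p), h ▸ (Nat.lt_floor_add_one (μ p)).le⟩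
    have hcard : (F.card : ℝ) ≤ 2 * ((1 + k) * E) := by
      have c1 := h₁ k hk (F.filter fun p => znorm p ≤ znorm (p + a))
        ((Finset.filter_subset _ _).trans (Finset.filter_subset _ _)) (by
          intro p hp
          obtain ⟨hp1, hp2⟩ := Finset.mem_filter.mp hp
          have h := hFμ p hp1
          simp only [hμ, min_eq_left hp2] at h
          exact ⟨h.1, h.2, hp2⟩)
      have c2 := h₂ k hk (F.filter fun p => ¬ znorm p ≤ znorm (p + a))
        ((Finset.filter_subset _ _).trans (Finset.filter_subset _ _)) (by
          intro p hp
          obtain ⟨hp1, hp2⟩ := Finset.mem_filter.mp hp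
          have h := hFμ p hp1
          simp only [hμ, min_eq_right (not_le.mp hp2).le] at h
          exact ⟨h.1, h.2, (not_le.mp hp2).le⟩)
      have c3 := Finset.card_filter_add_card_filter_not (s := F)
        (fun p => znorm p ≤ znorm (p + a))
      rw [← c3]
      push_cast
      linarith
    have hk0 : (0 : ℝ) < 1 + k := by positivity
    calc ∑ p ∈ F, jb (p + a) ^ (-γ) ≤ ∑ p ∈ F, 2 * (1 + (k : ℝ)) ^ (-γ) := by
          refine Finset.sum_le_sum fun p hp => ?_
          exact jb_rpow_neg_le hγ hγ1 (Nat.cast_nonneg k)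
            ((hFμ p hp).1.trans (min_le_right _ _))
      _ = F.card * (2 * (1 + (k : ℝ)) ^ (-γ)) := by rw [Finset.sum_const, nsmul_eq_mul]
      _ ≤ 2 * ((1 + k) * E) * (2 * (1 + (k : ℝ)) ^ (-γ)) := by gcongr
      _ = 4 * (1 + (k : ℝ)) ^ (1 - γ) * E := by
          rw [sub_eq_add_neg, Real.rpow_add hk0, Real.rpow_one]; ring
      _ ≤ 4 * (2 * R) ^ (1 - γ) * E := by
          gcongr
          · linarith
      _ ≤ 8 * R ^ (1 - γ) * E := by
          rw [Real.mul_rpow (by norm_num) (by linarith)]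
          have : (2 : ℝ) ^ (1 - γ) ≤ 2 ^ (1 : ℝ) :=
            Real.rpow_le_rpow_of_exponent_le (by norm_num) (by linarith)
          rw [Real.rpow_one] at this
          have h0 : 0 ≤ R ^ (1 - γ) * E := by positivity
          nlinarith
  calc _ ≤ ∑ k ∈ Finset.range (⌊R⌋₊ + 1), 8 * R ^ (1 - γ) * E := Finset.sum_le_sum hfib
    _ = (⌊R⌋₊ + 1) * (8 * R ^ (1 - γ) * E) := by simp
    _ ≤ (2 * R) * (8 * R ^ (1 - γ) * E) := by
        gcongr
        linarith [Nat.floor_le (show 0 ≤ R by linarith)]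
    _ = _ := by
        rw [show (2 : ℝ) - γ = 1 + (1 - γ) by ring, Real.rpow_add (by linarith), Real.rpow_one]
        ring

lemma sum_jb_rpow_le {γ : ℝ} (hγ : 0 ≤ γ) (hγ1 : γ ≤ 1) (a : Fin 3 → ℤ)
    (S : Finset (Fin 3 → ℤ)) {R : ℝ} (hR : 1 ≤ R) (hS : ∀ p ∈ S, znorm p ≤ R) :
    ∑ p ∈ S, jb (p + a) ^ (-γ) ≤ 28800 * R ^ (3 - γ) := by
  classical
  have key : ∀ k : ℕ, (k : ℝ) ≤ R → 900 * (1 + (k : ℝ)) ^ 2 ≤ (1 + k) * (1800 * R) := by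
    intro k hk
    have : (0 : ℝ) ≤ k := Nat.cast_nonneg k
    nlinarith
  refine (weighted_sum_le hγ hγ1 a S hR (E := 1800 * R) (by positivity) hS ?_ ?_).trans ?_
  · intro k hk S' _ h
    exact (card_shell_le S' k (Nat.cast_nonneg k) fun p hp => ⟨(h p hp).1, (h p hp).2.1⟩).trans
      (key k hk)
  · intro k hk S' _ h
    rw [← Finset.card_image_of_injective S' (add_left_injective a)]
    refine (card_shell_le _ k (Nat.cast_nonneg k) fun q hq => ?_).trans (key k hk)
    obtain ⟨p, hp, rfl⟩ := Finset.mem_image.mp hq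
    exact ⟨(h p hp).1, (h p hp).2.1⟩
  · rw [show (3 : ℝ) - γ = 1 + (2 - γ) by ring, Real.rpow_add (by linarith), Real.rpow_one]
    linarith

lemma sum_phase_jb_rpow_le {α γ : ℝ} (hα : 1 ≤ α) (hα' : α ≤ 3 / 2) (hγ : 0 ≤ γ) (hγ1 : γ ≤ 1)
    {σ τ : ℝ} (hσ : IsSign σ) (hτ : IsSign τ) (a : Fin 3 → ℤ) (c : ℝ)
    (S : Finset (Fin 3 → ℤ)) {R : ℝ} (hR : 1 ≤ R)
    (hS : ∀ p ∈ S, znorm p ≤ R ∧ |σ * jbb α (p + a) + τ * jbb α p - c| ≤ 1) :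
    ∑ p ∈ S, jb (p + a) ^ (-γ) ≤ 4160000 * R ^ (2 - γ) * (1 + R / jb a) := by
  classical
  have hja := jb_pos a
  have key : ∀ k : ℕ, (k : ℝ) ≤ R → 130000 * (1 + (k : ℝ)) * (1 + (1 + k) / jb a) ≤
      (1 + k) * (260000 * (1 + R / jb a)) := by
    intro k hk
    have h0 : (0 : ℝ) ≤ k := Nat.cast_nonneg k
    have h1 : (1 + k) / jb a ≤ 2 * (R / jb a) := by
      rw [← mul_div_assoc]
      gcongr
      linarith
    have h2 : 0 ≤ R / jb a := by positivity
    nlinarith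
  refine (weighted_sum_le hγ hγ1 a S hR (E := 260000 * (1 + R / jb a)) (by positivity)
    (fun p hp => (hS p hp).1) ?_ ?_).trans (le_of_eq (by ring))
  · intro k hk S' hS' h
    refine (card_shell_phase_le hα hα' hσ hτ a c S' k (Nat.cast_nonneg k) fun p hp => ?_).trans
      (key k hk)
    exact ⟨(h p hp).1, (h p hp).2.1, (h p hp).2.2, (hS p (hS' hp)).2⟩
  · intro k hk S' hS' h
    rw [← Finset.card_image_of_injective S' (add_left_injective a)]
    have hq := key k hk
    rw [← jb_neg a] at hq ⊢
    refine (card_shell_phase_le hα hα' hτ hσ (-a) c _ k (Nat.cast_nonneg k) fun q hq => ?_).trans hq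
    obtain ⟨p, hp, rfl⟩ := Finset.mem_image.mp hq
    simp only [add_neg_cancel_right]
    refine ⟨(h p hp).1, (h p hp).2.1, (h p hp).2.2, ?_⟩
    rw [add_comm (τ * _)]
    exact (hS p (hS' hp)).2

/-- The lattice points of Euclidean norm at most `R`. -/
def zball (R : ℝ) : Finset (Fin 3 → ℤ) :=
  open Classical in
  (Fintype.piFinset fun _ => Finset.Icc (-⌊R⌋) ⌊R⌋).filter fun n => znorm n ≤ R

lemma mem_zball {R : ℝ} {n : Fin 3 → ℤ} : n ∈ zball R ↔ znorm n ≤ R := by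
  rw [zball, Finset.mem_filter, and_iff_right_iff_imp, Fintype.mem_piFinset]
  intro h i
  have h1 := abs_le.mp ((abs_coord_le_znorm n i).trans h)
  rw [Finset.mem_Icc]
  refine ⟨?_, Int.le_floor.mpr h1.2⟩
  have : -n i ≤ ⌊R⌋ := Int.le_floor.mpr (by push_cast; linarith [h1.1])
  linarith

lemma card_zball_le {R : ℝ} (hR : 1 ≤ R) : ((zball R).card : ℝ) ≤ 27 * R ^ 3 := by
  have h : (zball R).card ≤ (2 * ⌊R⌋ + 1).toNat ^ 3 := by
    refine (Finset.card_filter_le _ _).trans (le_of_eq ?_)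
    rw [Fintype.card_piFinset]
    simp only [Int.card_Icc, Finset.prod_const, Finset.card_univ, Fintype.card_fin]
    congr 2
    ring
  have hfl : (0 : ℤ) ≤ ⌊R⌋ := Int.floor_nonneg.mpr (by linarith)
  have h2 : (((2 * ⌊R⌋ + 1).toNat : ℕ) : ℝ) = 2 * (⌊R⌋ : ℝ) + 1 := by
    have : (((2 * ⌊R⌋ + 1).toNat : ℕ) : ℤ) = 2 * ⌊R⌋ + 1 := Int.toNat_of_nonneg (by linarith)
    exact_mod_cast this
  calc ((zball R).card : ℝ) ≤ (((2 * ⌊R⌋ + 1).toNat : ℕ) : ℝ) ^ 3 := by exact_mod_cast h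
    _ ≤ (3 * R) ^ 3 := by
        rw [h2]
        have : (0 : ℝ) ≤ (⌊R⌋ : ℝ) := by exact_mod_cast hfl
        gcongr
        linarith [Int.floor_le R]
    _ = _ := by ring

lemma card_zball_pos {R : ℝ} (hR : 1 ≤ R) : 0 < ((zball R).card : ℝ) := by
  have : (0 : Fin 3 → ℤ) ∈ zball R := by
    rw [mem_zball]; simp [znorm]; linarith
  exact_mod_cast Finset.card_pos.mpr ⟨_, this⟩

/-! ### Sums over several lattice variables -/

lemma sum_update_piFinset {ι V : Type*} [Fintype ι] [DecidableEq ι] (t : ι → Finset V)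
    (j : ι) (G : (ι → V) → ℝ) :
    ∑ v ∈ Fintype.piFinset t, ∑ p ∈ t j, G (Function.update v j p) =
      (t j).card * ∑ v ∈ Fintype.piFinset t, G v := by
  have h : (t j).card * ∑ v ∈ Fintype.piFinset t, G v =
      ∑ v ∈ Fintype.piFinset t, ∑ _p ∈ t j, G v := by
    simp [Finset.mul_sum]
  rw [h, ← Finset.sum_product', ← Finset.sum_product']
  refine Finset.sum_nbij' (fun x => (Function.update x.1 j x.2, x.1 j))
    (fun x => (Function.update x.1 j x.2, x.1 j)) ?_ ?_ ?_ ?_ ?_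
  · rintro ⟨v, p⟩ hx
    simp only [Finset.mem_product, Fintype.mem_piFinset] at hx ⊢
    refine ⟨fun i => ?_, hx.1 j⟩
    by_cases hi : i = j
    · subst hi; simpa using hx.2
    · simpa [hi] using hx.1 i
  · rintro ⟨v, p⟩ hx
    simp only [Finset.mem_product, Fintype.mem_piFinset] at hx ⊢
    refine ⟨fun i => ?_, hx.1 j⟩
    by_cases hi : i = j
    · subst hi; simpa using hx.2
    · simpa [hi] using hx.1 i
  · rintro ⟨v, p⟩ _; simp
  · rintro ⟨v, p⟩ _; simp
  · rintro ⟨v, p⟩ _; rfl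

lemma sum_apply_update {ι V M : Type*} [DecidableEq ι] [AddCommMonoid M] (F : ι → V → M)
    (s : Finset ι) {j : ι} (hj : j ∈ s) (v : ι → V) (p : V) :
    ∑ i ∈ s, F i (Function.update v j p i) = F j p + ∑ i ∈ s.erase j, F i (v i) := by
  rw [← Finset.add_sum_erase s _ hj, Function.update_self]
  congr 1
  refine Finset.sum_congr rfl fun i hi => ?_
  rw [Function.update_of_ne (Finset.ne_of_mem_erase hi)]

lemma prod_mul_le_of_le {ι : Type*} [Fintype ι] [DecidableEq ι] {r B : ι → ℝ} (hr : ∀ i, 0 < r i)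
    (hrB : ∀ i, r i ≤ B i) (s : Finset ι) {X D : ℝ} (hD : 0 ≤ D)
    (h : (∏ i ∈ s, r i) * X ≤ (∏ i, r i) * D) : (∏ i ∈ s, B i) * X ≤ (∏ i, B i) * D := by
  rw [← Finset.prod_mul_prod_compl s r, mul_assoc] at h
  have h1 : X ≤ (∏ i ∈ sᶜ, r i) * D :=
    le_of_mul_le_mul_left h (Finset.prod_pos fun i _ => hr i)
  rw [← Finset.prod_mul_prod_compl s B, mul_assoc]
  apply mul_le_mul_of_nonneg_left _ (Finset.prod_nonneg fun i _ => ((hr i).trans_le (hrB i)).le)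
  refine h1.trans (mul_le_mul_of_nonneg_right ?_ hD)
  exact Finset.prod_le_prod (fun i _ => (hr i).le) fun i _ => hrB i

lemma card_piFinset_zball {ι : Type*} [Fintype ι] [DecidableEq ι] (N : ι → ℝ) :
    ((Fintype.piFinset fun i => zball (N i)).card : ℝ) = ∏ i, ((zball (N i)).card : ℝ) := by
  rw [Fintype.card_piFinset]
  push_cast
  rfl

lemma card_piFinset_zball_le {ι : Type*} [Fintype ι] [DecidableEq ι] {N : ι → ℝ}
    (hN : ∀ i, 1 ≤ N i) :
    ((Fintype.piFinset fun i => zball (N i)).card : ℝ) ≤ ∏ i, (27 * N i ^ 3) := by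
  rw [card_piFinset_zball]
  exact Finset.prod_le_prod (fun i _ => Nat.cast_nonneg _) fun i _ => card_zball_le (hN i)

lemma multi_sum_jb_rpow_le {ι : Type*} [Fintype ι] [DecidableEq ι] {γ : ℝ} (hγ : 0 ≤ γ)
    (hγ1 : γ ≤ 1) {N : ι → ℝ} (hN : ∀ i, 1 ≤ N i) (b : Fin 3 → ℤ) (j : ι) :
    ∑ v ∈ Fintype.piFinset (fun i => zball (N i)), jb (∑ i, v i + b) ^ (-γ) ≤
      28800 * (∏ i, (27 * N i ^ 3)) * N j ^ (-γ) := by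
  have hNj : 0 < N j := lt_of_lt_of_le one_pos (hN j)
  set G : (ι → Fin 3 → ℤ) → ℝ := fun v => jb (∑ i, v i + b) ^ (-γ) with hG
  have h : (∏ i ∈ {j}, ((zball (N i)).card : ℝ)) *
      ∑ v ∈ Fintype.piFinset (fun i => zball (N i)), G v ≤
      (∏ i, ((zball (N i)).card : ℝ)) * (28800 * N j ^ (3 - γ)) := by
    rw [Finset.prod_singleton, ← sum_update_piFinset (fun i => zball (N i)) j G,
      ← card_piFinset_zball, ← nsmul_eq_mul, ← Finset.sum_const]
    refine Finset.sum_le_sum fun v _ => ?_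
    have e : ∀ p, G (Function.update v j p) =
        jb (p + (∑ i ∈ Finset.univ.erase j, v i + b)) ^ (-γ) := by
      intro p
      simp only [hG]
      rw [sum_apply_update (fun _ x => x) Finset.univ (Finset.mem_univ j), add_assoc]
    simp only [e]
    exact sum_jb_rpow_le hγ hγ1 _ _ (hN j) fun p hp => mem_zball.mp hp
  have h2 := prod_mul_le_of_le (fun i => card_zball_pos (hN i)) (fun i => card_zball_le (hN i))
    {j} (by positivity) h
  rw [Finset.prod_singleton] at h2
  have e : N j ^ (3 - γ) = N j ^ 3 * N j ^ (-γ) := by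
    rw [sub_eq_add_neg, Real.rpow_add hNj]; norm_cast
  rw [e] at h2
  have hP : 0 ≤ ∏ i, (27 * N i ^ 3) :=
    Finset.prod_nonneg fun i _ => by have := hN i; positivity
  have hN3 : 0 < N j ^ 3 := by positivity
  have hGn : 0 ≤ ∑ v ∈ Fintype.piFinset (fun i => zball (N i)), G v :=
    Finset.sum_nonneg fun v _ => Real.rpow_nonneg (jb_nonneg _) _
  refine le_of_mul_le_mul_left ?_ hN3
  calc N j ^ 3 * ∑ v ∈ Fintype.piFinset (fun i => zball (N i)), G v
      ≤ 27 * N j ^ 3 * ∑ v ∈ Fintype.piFinset (fun i => zball (N i)), G v := by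
        apply mul_le_mul_of_nonneg_right _ hGn
        linarith
    _ ≤ _ := h2
    _ = _ := by ring

lemma ind_nonneg (p : Prop) : 0 ≤ ind p := by
  unfold ind; split_ifs <;> norm_num

lemma ind_le_one (p : Prop) : ind p ≤ 1 := by
  unfold ind; split_ifs <;> norm_num

lemma ind_of_true {p : Prop} (h : p) : ind p = 1 := by simp [ind, h]

lemma ind_of_false {p : Prop} (h : ¬ p) : ind p = 0 := by simp [ind, h]

lemma multi_sum_phase_le {ι : Type*} [Fintype ι] [DecidableEq ι] {α γ : ℝ} (hα : 1 ≤ α)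
    (hα' : α ≤ 3 / 2) (hγ : 0 ≤ γ) (hγ1 : γ ≤ 1) {σ : ℝ} (hσ : IsSign σ) {τ : ι → ℝ}
    (hτ : ∀ i, IsSign (τ i)) {N : ι → ℝ} (hN : ∀ i, 1 ≤ N i) (b : Fin 3 → ℤ) (c : ℝ)
    {j₁ j₂ : ι} (hj : j₁ ≠ j₂) (hNj : N j₂ ≤ N j₁) :
    ∑ v ∈ Fintype.piFinset (fun i => zball (N i)),
      ind (|σ * jbb α (∑ i, v i + b) + ∑ i, τ i * jbb α (v i) - c| ≤ 1) *
        jb (∑ i, v i + b) ^ (-γ) ≤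
      4160000 * 28827 * (∏ i, (27 * N i ^ 3)) * (N j₁ ^ (-γ) * N j₂ ^ (-γ)) := by
  classical
  have hN1 : 0 < N j₁ := lt_of_lt_of_le one_pos (hN j₁)
  have hN2 : 0 < N j₂ := lt_of_lt_of_le one_pos (hN j₂)
  set G : (ι → Fin 3 → ℤ) → ℝ := fun v =>
    ind (|σ * jbb α (∑ i, v i + b) + ∑ i, τ i * jbb α (v i) - c| ≤ 1) *
        jb (∑ i, v i + b) ^ (-γ) with hG
  set D : (ι → Fin 3 → ℤ) → ℝ := fun v => 4160000 * N j₁ ^ (2 - γ) *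
    (1 + N j₁ * jb (∑ i ∈ Finset.univ.erase j₁, v i + b) ^ (-1 : ℝ)) with hD
  have hGD : ((zball (N j₁)).card : ℝ) * ∑ v ∈ Fintype.piFinset (fun i => zball (N i)), G v ≤
      ∑ v ∈ Fintype.piFinset (fun i => zball (N i)), D v := by
    rw [← sum_update_piFinset (fun i => zball (N i)) j₁ G]
    refine Finset.sum_le_sum fun v _ => ?_
    set a := ∑ i ∈ Finset.univ.erase j₁, v i + b with ha
    set c' := c - ∑ i ∈ Finset.univ.erase j₁, τ i * jbb α (v i) with hc'
    have e : ∀ p, G (Function.update v j₁ p) =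
        if |σ * jbb α (p + a) + τ j₁ * jbb α p - c'| ≤ 1 then jb (p + a) ^ (-γ) else 0 := by
      intro p
      simp only [hG]
      rw [sum_apply_update (fun _ x => x) Finset.univ (Finset.mem_univ j₁),
        sum_apply_update (fun i x => τ i * jbb α x) Finset.univ (Finset.mem_univ j₁), add_assoc,
        ← ha, show σ * jbb α (p + a) + (τ j₁ * jbb α p +
          ∑ i ∈ Finset.univ.erase j₁, τ i * jbb α (v i)) - c =
          σ * jbb α (p + a) + τ j₁ * jbb α p - c' by rw [hc']; ring]
      simp only [ind, ite_mul, one_mul, zero_mul]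
    simp only [e]
    rw [← Finset.sum_filter]
    refine (sum_phase_jb_rpow_le hα hα' hγ hγ1 hσ (hτ j₁) a c' _ (hN j₁) fun p hp => ?_).trans
      (le_of_eq ?_)
    · rw [Finset.mem_filter, mem_zball] at hp
      exact hp
    · simp only [hD]
      rw [Real.rpow_neg_one, ← ha, div_eq_mul_inv]
  have hDE : ((zball (N j₂)).card : ℝ) * ∑ v ∈ Fintype.piFinset (fun i => zball (N i)), D v ≤
      (∏ i, ((zball (N i)).card : ℝ)) *
        (4160000 * 28827 * (N j₁ ^ (3 - γ) * N j₂ ^ 2)) := by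
    rw [← sum_update_piFinset (fun i => zball (N i)) j₂ D,
      ← card_piFinset_zball, ← nsmul_eq_mul, ← Finset.sum_const]
    refine Finset.sum_le_sum fun v _ => ?_
    set b' := ∑ i ∈ (Finset.univ.erase j₁).erase j₂, v i + b with hb'
    have e : ∀ q, D (Function.update v j₂ q) =
        4160000 * N j₁ ^ (2 - γ) * (1 + N j₁ * jb (q + b') ^ (-1 : ℝ)) := by
      intro q
      simp only [hD]
      rw [sum_apply_update (fun _ x => x) (Finset.univ.erase j₁)
        (Finset.mem_erase.mpr ⟨hj.symm, Finset.mem_univ _⟩), add_assoc, ← hb']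
    simp only [e]
    rw [← Finset.mul_sum, Finset.sum_add_distrib, ← Finset.mul_sum, Finset.sum_const,
      nsmul_eq_mul, mul_one]
    have h1 := sum_jb_rpow_le zero_le_one le_rfl b' (zball (N j₂)) (hN j₂)
      fun p hp => mem_zball.mp hp
    rw [show (3 : ℝ) - 1 = ((2 : ℕ) : ℝ) by norm_num, Real.rpow_natCast] at h1
    have h2 := card_zball_le (hN j₂)
    have h3 : N j₁ ^ (3 - γ) = N j₁ ^ (2 - γ) * N j₁ := by
      rw [← Real.rpow_add_one hN1.ne']; congr 1; ring
    rw [h3]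
    calc _ ≤ 4160000 * N j₁ ^ (2 - γ) * (27 * N j₂ ^ 3 + N j₁ * (28800 * N j₂ ^ 2)) := by
          gcongr
      _ ≤ 4160000 * N j₁ ^ (2 - γ) * (27 * (N j₁ * N j₂ ^ 2) + N j₁ * (28800 * N j₂ ^ 2)) := by
          gcongr
          rw [pow_succ' (N j₂) 2]
          gcongr
      _ = _ := by ring
  have h : (∏ i ∈ {j₁, j₂}, ((zball (N i)).card : ℝ)) *
      ∑ v ∈ Fintype.piFinset (fun i => zball (N i)), G v ≤
      (∏ i, ((zball (N i)).card : ℝ)) *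
        (4160000 * 28827 * (N j₁ ^ (3 - γ) * N j₂ ^ 2)) := by
    rw [Finset.prod_pair hj, mul_comm ((zball (N j₁)).card : ℝ), mul_assoc]
    exact (mul_le_mul_of_nonneg_left hGD (Nat.cast_nonneg _)).trans hDE
  have h2 := prod_mul_le_of_le (fun i => card_zball_pos (hN i)) (fun i => card_zball_le (hN i))
    {j₁, j₂} (by positivity) h
  rw [Finset.prod_pair hj] at h2
  have e : N j₁ ^ (3 - γ) = N j₁ ^ 3 * N j₁ ^ (-γ) := by
    rw [sub_eq_add_neg, Real.rpow_add hN1]; norm_cast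
  have e2 : N j₂ ^ 2 ≤ N j₂ ^ 3 * N j₂ ^ (-γ) := by
    have : N j₂ ^ (-1 : ℝ) ≤ N j₂ ^ (-γ) :=
      Real.rpow_le_rpow_of_exponent_le (hN j₂) (by linarith)
    calc N j₂ ^ 2 = N j₂ ^ 3 * N j₂ ^ (-1 : ℝ) := by
          rw [Real.rpow_neg_one]; field_simp
      _ ≤ _ := by gcongr
  rw [e] at h2
  have hP : 0 ≤ ∏ i, (27 * N i ^ 3) :=
    Finset.prod_nonneg fun i _ => by have := hN i; positivity
  have hN3 : 0 < N j₁ ^ 3 * N j₂ ^ 3 := by positivity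
  have hGn : 0 ≤ ∑ v ∈ Fintype.piFinset (fun i => zball (N i)), G v :=
    Finset.sum_nonneg fun v _ => mul_nonneg (ind_nonneg _) (Real.rpow_nonneg (jb_nonneg _) _)
  refine le_of_mul_le_mul_left ?_ hN3
  calc N j₁ ^ 3 * N j₂ ^ 3 * ∑ v ∈ Fintype.piFinset (fun i => zball (N i)), G v
      ≤ 27 * N j₁ ^ 3 * (27 * N j₂ ^ 3) *
          ∑ v ∈ Fintype.piFinset (fun i => zball (N i)), G v := by
        apply mul_le_mul_of_nonneg_right _ hGn
        nlinarith
    _ ≤ _ := h2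
    _ ≤ (∏ i, (27 * N i ^ 3)) * (4160000 * 28827 * (N j₁ ^ 3 * N j₁ ^ (-γ) *
          (N j₂ ^ 3 * N j₂ ^ (-γ)))) := by gcongr
    _ = _ := by ring

/-! ### A Schur test -/

lemma schur_test {X Y : Type*} (K P Q : Y → X → ℝ) (FX : Finset X) (FY : Finset Y) {L A B : ℝ}
    (hK : ∀ y x, K y x ≠ 0 → x ∈ FX ∧ y ∈ FY) (hP : ∀ y x, 0 ≤ P y x) (hQ : ∀ y x, 0 ≤ Q y x)
    (hL : 0 ≤ L) (hA : 0 ≤ A) (hB : 0 ≤ B)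
    (hKPQ : ∀ y x, K y x ^ 2 ≤ L * (P y x * Q y x))
    (hPA : ∀ y, ∑ x ∈ FX, P y x ≤ A) (hQB : ∀ x, ∑ y ∈ FY, Q y x ≤ B)
    (f : X → ℝ) (hf : ∑' x, f x ^ 2 = 1) :
    ∑' y, (∑' x, K y x * f x) ^ 2 ≤ L * (A * B) := by
  have hinner : ∀ y, ∑' x, K y x * f x = ∑ x ∈ FX, K y x * f x := by
    intro y
    refine tsum_eq_sum fun x hx => ?_
    have : K y x = 0 := by
      by_contra h
      exact hx (hK y x h).1
    rw [this, zero_mul]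
  have houter : ∑' y, (∑' x, K y x * f x) ^ 2 = ∑ y ∈ FY, (∑ x ∈ FX, K y x * f x) ^ 2 := by
    simp only [hinner]
    refine tsum_eq_sum fun y hy => ?_
    rw [Finset.sum_eq_zero fun x _ => ?_, sq, zero_mul]
    have : K y x = 0 := by
      by_contra h
      exact hy (hK y x h).2
    rw [this, zero_mul]
  have hf1 : ∑ x ∈ FX, f x ^ 2 ≤ 1 := by
    rw [← hf]
    refine Summable.sum_le_tsum FX (fun _ _ => sq_nonneg _) ?_
    by_contra h
    rw [tsum_eq_zero_of_not_summable h] at hf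
    exact zero_ne_one hf
  rw [houter]
  calc ∑ y ∈ FY, (∑ x ∈ FX, K y x * f x) ^ 2
      ≤ ∑ y ∈ FY, A * ∑ x ∈ FX, L * (Q y x * f x ^ 2) := by
        refine Finset.sum_le_sum fun y _ => ?_
        calc (∑ x ∈ FX, K y x * f x) ^ 2
            ≤ (∑ x ∈ FX, P y x) * ∑ x ∈ FX, L * (Q y x * f x ^ 2) := by
              refine Finset.sum_sq_le_sum_mul_sum_of_sq_le_mul FX (fun x _ => hP y x)
                (fun x _ => mul_nonneg hL (mul_nonneg (hQ y x) (sq_nonneg _))) fun x _ => ?_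
              rw [mul_pow]
              nlinarith [mul_le_mul_of_nonneg_right (hKPQ y x) (sq_nonneg (f x))]
          _ ≤ _ := by
              apply mul_le_mul_of_nonneg_right (hPA y)
              exact Finset.sum_nonneg fun x _ =>
                mul_nonneg hL (mul_nonneg (hQ y x) (sq_nonneg _))
    _ = L * A * ∑ x ∈ FX, (∑ y ∈ FY, Q y x) * f x ^ 2 := by
        rw [← Finset.mul_sum, Finset.sum_comm, mul_comm L A, mul_assoc]
        congr 1
        rw [Finset.mul_sum]
        refine Finset.sum_congr rfl fun x _ => ?_
        rw [Finset.sum_mul, Finset.mul_sum]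
    _ ≤ L * A * ∑ x ∈ FX, B * f x ^ 2 := by
        gcongr with x _
        exact hQB x
    _ ≤ L * (A * B) := by
        rw [← Finset.mul_sum]
        have := mul_le_mul_of_nonneg_left hf1 (mul_nonneg (mul_nonneg hL hA) hB)
        linarith

lemma half_le_jb {N : ℝ} {n : Fin 3 → ℤ} (h : SimFreq N n) : N / 2 ≤ jb n := by
  rcases h with ⟨_, h, _⟩ | ⟨h, _⟩
  · exact h.le.trans (znorm_le_jb n)
  · linarith [one_le_jb n]

lemma SimFreq.znorm_le {N : ℝ} (hN : 1 ≤ N) {n : Fin 3 → ℤ} (h : SimFreq N n) :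
    znorm n ≤ N := by
  rcases h with ⟨_, _, h⟩ | ⟨_, h⟩
  · exact h
  · exact h.trans hN

lemma IsDyadic.one_le {N : ℝ} (h : IsDyadic N) : 1 ≤ N := by
  obtain ⟨j, rfl⟩ := h
  exact one_le_pow₀ (by norm_num)

lemma rpow_div_le_jbb_sq {α N : ℝ} (hα : 1 ≤ α) (hα' : α ≤ 3 / 2) (hN : 1 ≤ N) {n : Fin 3 → ℤ}
    (h : SimFreq N n) : N ^ (2 * α) / 64 ≤ jbb α n ^ 2 := by
  have h1 : 1 ≤ jb n ^ (2 * α) := Real.one_le_rpow (one_le_jb n) (by linarith)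
  have h2 : (N / 2) ^ (2 * α) ≤ jb n ^ (2 * α) :=
    Real.rpow_le_rpow (by linarith) (half_le_jb h) (by linarith)
  have h3 : (2 : ℝ) ^ (2 * α) ≤ 8 := by
    calc (2 : ℝ) ^ (2 * α) ≤ 2 ^ (3 : ℝ) :=
          Real.rpow_le_rpow_of_exponent_le (by norm_num) (by linarith)
      _ = 8 := by norm_num
  have h4 : (0 : ℝ) < 2 ^ (2 * α) := by positivity
  have h5 : 0 ≤ N ^ (2 * α) := by positivity
  rw [Real.div_rpow (by linarith) (by norm_num), div_le_iff₀ h4] at h2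
  rw [jbb, Real.sq_sqrt (by linarith)]
  nlinarith

lemma ind_ne_zero {p : Prop} (h : ind p ≠ 0) : p := by
  by_contra h'
  exact h (ind_of_false h')

lemma sum_prod_ind_mul_le {X V : Type*} (S : Finset X) (T : Finset V)
    (p : X → V → Prop) (g : V → X) (hp : ∀ x v, p x v → x = g v) (F : X → V → ℝ)
    (hF : ∀ x v, 0 ≤ F x v) :
    ∑ z ∈ S ×ˢ T, ind (p z.1 z.2) * F z.1 z.2 ≤ ∑ v ∈ T, F (g v) v := by
  classical
  rw [Finset.sum_product_right]
  refine Finset.sum_le_sum fun v _ => ?_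
  calc ∑ x ∈ S, ind (p x v) * F x v ≤ ∑ x ∈ S, if x = g v then F (g v) v else 0 := by
        refine Finset.sum_le_sum fun x _ => ?_
        by_cases h : p x v
        · rw [ind_of_true h, if_pos (hp x v h), one_mul, ← hp x v h]
        · rw [ind_of_false h, zero_mul]
          split_ifs
          · exact hF _ _
          · exact le_rfl
    _ ≤ F (g v) v := by
        rw [Finset.sum_ite_eq']
        split_ifs
        · exact le_rfl
        · exact hF _ _

lemma kernel_sq_le {ι : Type*} [Fintype ι] {α s ε' η N Nk : ℝ} (hα : 1 ≤ α) (hα' : α ≤ 3 / 2)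
    (hη : 0 ≤ η) (hη1 : η ≤ 1) (hs : 3 - 2 * α + 2 * η ≤ 2 * s)
    (hs' : 2 * (s - α + ε') ≤ -(3 - 2 * α + η)) (hNk : 1 ≤ Nk)
    {Nv : ι → ℝ} (hNv : ∀ j, 1 ≤ Nv j) (p q : Prop) (n nk : Fin 3 → ℤ) (nv : ι → Fin 3 → ℤ) :
    (ind p * (∏ j, ind (SimFreq (Nv j) (nv j)) * ind (znorm (nv j) ≤ N)) *
        (ind (SimFreq Nk nk) * ind (znorm nk ≤ N)) * ind q *
        (jb n ^ (s - α + ε') / ((∏ j, jbb α (nv j)) * jb nk ^ s))) ^ 2 ≤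
      (∏ j, 64 * Nv j ^ (-(2 * α))) * (2 * Nk ^ (-η)) *
        (ind p * (ind q * jb n ^ (-(3 - 2 * α + η)) * jb nk ^ (-(3 - 2 * α + η)))) := by
  set γ := 3 - 2 * α + η with hγ
  have hR : 0 ≤ (∏ j, 64 * Nv j ^ (-(2 * α))) * (2 * Nk ^ (-η)) *
        (ind p * (ind q * jb n ^ (-γ) * jb nk ^ (-γ))) := by
    have h1 : 0 ≤ ∏ j, 64 * Nv j ^ (-(2 * α)) := Finset.prod_nonneg fun j _ => by
      have := hNv j
      positivity
    have := ind_nonneg p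
    have := ind_nonneg q
    have := jb_nonneg n
    have := jb_nonneg nk
    positivity
  by_cases hall : p ∧ q ∧ SimFreq Nk nk ∧ ∀ j, SimFreq (Nv j) (nv j)
  swap
  · suffices h : ind p * (∏ j, ind (SimFreq (Nv j) (nv j)) * ind (znorm (nv j) ≤ N)) *
        (ind (SimFreq Nk nk) * ind (znorm nk ≤ N)) * ind q = 0 by
      rw [h]; simpa using hR
    by_contra hne
    simp only [mul_eq_zero, not_or, Finset.prod_eq_zero_iff, not_exists, not_and] at hne
    exact hall ⟨ind_ne_zero hne.1.1.1, ind_ne_zero hne.2, ind_ne_zero hne.1.2.1,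
      fun j => ind_ne_zero (hne.1.1.2 j (Finset.mem_univ j)).1⟩
  obtain ⟨hp, hq, hk, hv⟩ := hall
  have hjn := jb_pos n
  have hjk := jb_pos nk
  have hP0 : 0 ≤ ∏ j, ind (SimFreq (Nv j) (nv j)) * ind (znorm (nv j) ≤ N) :=
    Finset.prod_nonneg fun j _ => mul_nonneg (ind_nonneg _) (ind_nonneg _)
  have hP1 : ∏ j, ind (SimFreq (Nv j) (nv j)) * ind (znorm (nv j) ≤ N) ≤ 1 :=
    Finset.prod_le_one (fun j _ => mul_nonneg (ind_nonneg _) (ind_nonneg _)) fun j _ =>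
      mul_le_one₀ (ind_le_one _) (ind_nonneg _) (ind_le_one _)
  set a := ∏ j, ind (SimFreq (Nv j) (nv j)) * ind (znorm (nv j) ≤ N)
  have hb0 := ind_nonneg (znorm nk ≤ N)
  have hb1 := ind_le_one (znorm nk ≤ N)
  set b := ind (znorm nk ≤ N)
  rw [ind_of_true hp, ind_of_true hq, ind_of_true hk, one_mul, one_mul, mul_one, one_mul, one_mul,
    mul_pow, div_pow, mul_pow (∏ j, jbb α (nv j))]
  have hab : (a * b) ^ 2 ≤ 1 := pow_le_one₀ (mul_nonneg hP0 hb0) (mul_le_one₀ hP1 hb0 hb1)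
  have hn : (jb n ^ (s - α + ε')) ^ 2 ≤ jb n ^ (-γ) := by
    rw [← Real.rpow_natCast, ← Real.rpow_mul hjn.le]
    exact Real.rpow_le_rpow_of_exponent_le (one_le_jb n) (by push_cast; linarith)
  have hkk : ((jb nk ^ s) ^ 2)⁻¹ ≤ 2 * Nk ^ (-η) * jb nk ^ (-γ) := by
    have e1 : ((jb nk ^ s) ^ 2)⁻¹ = jb nk ^ (-(2 * s)) := by
      rw [← Real.rpow_natCast, ← Real.rpow_mul hjk.le, ← Real.rpow_neg hjk.le]
      push_cast
      ring_nf
    have e2 : jb nk ^ (-(2 * s)) ≤ jb nk ^ (-η) * jb nk ^ (-γ) := by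
      rw [← Real.rpow_add hjk]
      exact Real.rpow_le_rpow_of_exponent_le (one_le_jb nk) (by linarith)
    have e3 : jb nk ^ (-η) ≤ 2 * Nk ^ (-η) := by
      calc jb nk ^ (-η) ≤ (Nk / 2) ^ (-η) :=
            Real.rpow_le_rpow_of_nonpos (by linarith) (half_le_jb hk) (by linarith)
        _ = 2 ^ η * Nk ^ (-η) := by
            rw [Real.div_rpow (by linarith) (by norm_num), Real.rpow_neg (by norm_num : (0:ℝ) ≤ 2)]
            field_simp
        _ ≤ 2 * Nk ^ (-η) := by
            gcongr
            calc (2 : ℝ) ^ η ≤ 2 ^ (1 : ℝ) :=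
                  Real.rpow_le_rpow_of_exponent_le (by norm_num) hη1
              _ = 2 := by norm_num
    rw [e1]
    exact e2.trans (mul_le_mul_of_nonneg_right e3 (by positivity))
  have hvv : ((∏ j, jbb α (nv j)) ^ 2)⁻¹ ≤ ∏ j, 64 * Nv j ^ (-(2 * α)) := by
    rw [← Finset.prod_pow, ← Finset.prod_inv_distrib]
    refine Finset.prod_le_prod (fun j _ => by positivity) fun j _ => ?_
    have h0 : 0 < Nv j := lt_of_lt_of_le one_pos (hNv j)
    calc (jbb α (nv j) ^ 2)⁻¹ ≤ (Nv j ^ (2 * α) / 64)⁻¹ :=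
          inv_anti₀ (by positivity) (rpow_div_le_jbb_sq hα hα' (hNv j) (hv j))
      _ = 64 * Nv j ^ (-(2 * α)) := by
          rw [Real.rpow_neg h0.le]
          field_simp
  rw [div_eq_mul_inv, mul_inv]
  have hD0 : 0 ≤ ∏ j, 64 * Nv j ^ (-(2 * α)) := (by positivity : (0:ℝ) ≤ _).trans hvv
  calc (a * b) ^ 2 * ((jb n ^ (s - α + ε')) ^ 2 *
        (((∏ j, jbb α (nv j)) ^ 2)⁻¹ * ((jb nk ^ s) ^ 2)⁻¹))
      ≤ 1 * (jb n ^ (-γ) * ((∏ j, 64 * Nv j ^ (-(2 * α))) * (2 * Nk ^ (-η) * jb nk ^ (-γ)))) := by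
        gcongr
    _ = _ := by ring

lemma freq_prod_le {ι : Type*} [Fintype ι] [DecidableEq ι] {β η Nk M : ℝ} (hβ : 0 ≤ β)
    (hη : 0 ≤ η) (hNk : 1 ≤ Nk) {Nv : ι → ℝ} (hNv : ∀ j, 1 ≤ Nv j) (hM : ∀ j, Nv j ≤ M)
    {j₁ j₂ : ι} (hj : j₁ ≠ j₂) (hmax : M ≤ Nv j₁ ∨ M ≤ Nk) :
    (∏ j, Nv j ^ β) * Nk ^ (-η) * (Nv j₁ ^ (-(β + η)) * Nv j₂ ^ (-(β + η))) ≤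
      M ^ (((Fintype.card ι : ℝ) - 2) * β - η) := by
  have hpos : ∀ j, 0 < Nv j := fun j => lt_of_lt_of_le one_pos (hNv j)
  have hM0 : 0 < M := (hpos j₁).trans_le (hM j₁)
  have hM1 : 1 ≤ M := (hNv j₁).trans (hM j₁)
  have hmem : j₂ ∈ Finset.univ.erase j₁ := Finset.mem_erase.mpr ⟨hj.symm, Finset.mem_univ _⟩
  have hcard : (((Finset.univ.erase j₁).erase j₂).card : ℝ) = (Fintype.card ι : ℝ) - 2 := by
    have h1 := Finset.card_erase_add_one hmem
    have h2 := Finset.card_erase_add_one (Finset.mem_univ j₁)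
    rw [Finset.card_univ] at h2
    rw [← h2, ← h1]
    push_cast
    ring
  rw [← Finset.mul_prod_erase _ _ (Finset.mem_univ j₁), ← Finset.mul_prod_erase _ _ hmem]
  have hrest : ∏ j ∈ (Finset.univ.erase j₁).erase j₂, Nv j ^ β ≤
      M ^ (((Fintype.card ι : ℝ) - 2) * β) := by
    calc ∏ j ∈ (Finset.univ.erase j₁).erase j₂, Nv j ^ β
        ≤ ∏ j ∈ (Finset.univ.erase j₁).erase j₂, M ^ β :=
          Finset.prod_le_prod (fun j _ => Real.rpow_nonneg (hpos j).le _) fun j _ =>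
            Real.rpow_le_rpow (hpos j).le (hM j) hβ
      _ = M ^ (((Fintype.card ι : ℝ) - 2) * β) := by
          rw [Finset.prod_const, ← hcard, mul_comm, Real.rpow_mul_natCast hM0.le]
  have hle1 : ∀ {x : ℝ}, 1 ≤ x → x ^ (-η) ≤ 1 := fun hx =>
    Real.rpow_le_one_of_one_le_of_nonpos hx (by linarith)
  have hgain : Nv j₁ ^ (-η) * Nv j₂ ^ (-η) * Nk ^ (-η) ≤ M ^ (-η) := by
    have a1 := hle1 (hNv j₁)
    have a2 := hle1 (hNv j₂)
    have a3 := hle1 hNk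
    have b1 := Real.rpow_nonneg (hpos j₁).le (-η)
    have b2 := Real.rpow_nonneg (hpos j₂).le (-η)
    have b3 : 0 ≤ Nk ^ (-η) := by positivity
    rcases hmax with h | h
    · have h' : Nv j₁ ^ (-η) ≤ M ^ (-η) := Real.rpow_le_rpow_of_nonpos hM0 h (by linarith)
      calc Nv j₁ ^ (-η) * Nv j₂ ^ (-η) * Nk ^ (-η) ≤ M ^ (-η) * 1 * 1 := by gcongr
        _ = M ^ (-η) := by ring
    · have h' : Nk ^ (-η) ≤ M ^ (-η) := Real.rpow_le_rpow_of_nonpos hM0 h (by linarith)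
      calc Nv j₁ ^ (-η) * Nv j₂ ^ (-η) * Nk ^ (-η) ≤ 1 * 1 * M ^ (-η) := by gcongr
        _ = M ^ (-η) := by ring
  have hs : ∀ j, Nv j ^ β * Nv j ^ (-(β + η)) = Nv j ^ (-η) := fun j => by
    rw [← Real.rpow_add (hpos j)]
    ring_nf
  calc _ = (∏ j ∈ (Finset.univ.erase j₁).erase j₂, Nv j ^ β) *
        ((Nv j₁ ^ β * Nv j₁ ^ (-(β + η))) * (Nv j₂ ^ β * Nv j₂ ^ (-(β + η))) * Nk ^ (-η)) := by
        ring
    _ ≤ M ^ (((Fintype.card ι : ℝ) - 2) * β) * M ^ (-η) := by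
        rw [hs, hs]
        have := Real.rpow_nonneg (hpos j₁).le (-η)
        have := Real.rpow_nonneg (hpos j₂).le (-η)
        gcongr
    _ = _ := by rw [← Real.rpow_add hM0]; ring_nf

lemma tensor_schur {ι : Type*} [Fintype ι] [DecidableEq ι] {α s ε' η N Nk : ℝ}
    (hα : 1 ≤ α) (hα' : α ≤ 3 / 2) (hη : 0 ≤ η) (hη1 : η ≤ 1) (hs : 3 - 2 * α + 2 * η ≤ 2 * s)
    (hs' : 2 * (s - α + ε') ≤ -(3 - 2 * α + η)) (hNk : 1 ≤ Nk)
    {Nv : ι → ℝ} (hNv : ∀ j, 1 ≤ Nv j) (σ σk ζ : ℝ) (τ : ι → ℝ) (B : Finset ι)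
    (P Q : (Fin 3 → ℤ) × ({j : ι // j ∉ B} → Fin 3 → ℤ) →
      (Fin 3 → ℤ) × ({j : ι // j ∈ B} → Fin 3 → ℤ) → ℝ)
    (hP : ∀ y x, 0 ≤ P y x) (hQ : ∀ y x, 0 ≤ Q y x)
    (hPQ : ∀ y x, ind (|σ * jbb α y.1 + ((∑ j, τ j.1 * jbb α (x.2 j)) +
        ∑ j, τ j.1 * jbb α (y.2 j)) + σk * jbb α x.1 - ζ| ≤ 1) *
          jb y.1 ^ (-(3 - 2 * α + η)) * jb x.1 ^ (-(3 - 2 * α + η)) ≤ P y x * Q y x)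
    {A D : ℝ} (hA : 0 ≤ A) (hD : 0 ≤ D)
    (hrow : ∀ y, ∑ v ∈ Fintype.piFinset (fun j : {j : ι // j ∈ B} => zball (Nv j)),
      P y (-(∑ j, v j + (∑ j, y.2 j - y.1)), v) ≤ A)
    (hcol : ∀ x, ∑ v ∈ Fintype.piFinset (fun j : {j : ι // j ∉ B} => zball (Nv j)),
      Q (∑ j, v j + (∑ j, x.2 j + x.1), v) x ≤ D)
    (f : (Fin 3 → ℤ) × ({j : ι // j ∈ B} → Fin 3 → ℤ) → ℝ) (hf : ∑' x, f x ^ 2 = 1) :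
    (∑' y : (Fin 3 → ℤ) × ({j : ι // j ∉ B} → Fin 3 → ℤ),
      (∑' x : (Fin 3 → ℤ) × ({j : ι // j ∈ B} → Fin 3 → ℤ),
        (fun nv : ι → Fin 3 → ℤ =>
          ind (y.1 = (∑ j, nv j) + x.1) *
            (∏ j, ind (SimFreq (Nv j) (nv j)) * ind (znorm (nv j) ≤ N)) *
            (ind (SimFreq Nk x.1) * ind (znorm x.1 ≤ N)) *
            ind (|σ * jbb α ((∑ j, nv j) + x.1) + (∑ j, τ j * jbb α (nv j)) +
              σk * jbb α x.1 - ζ| ≤ 1) *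
            (jb y.1 ^ (s - α + ε') / ((∏ j, jbb α (nv j)) * jb x.1 ^ s)) * f x)
        (fun j => if h : j ∈ B then x.2 ⟨j, h⟩ else y.2 ⟨j, h⟩)) ^ 2) ≤
      (∏ j, 64 * Nv j ^ (-(2 * α))) * (2 * Nk ^ (-η)) * (A * D) := by
  classical
  set nv : (Fin 3 → ℤ) × ({j : ι // j ∉ B} → Fin 3 → ℤ) →
      (Fin 3 → ℤ) × ({j : ι // j ∈ B} → Fin 3 → ℤ) → ι → Fin 3 → ℤ :=
    fun y x j => if h : j ∈ B then x.2 ⟨j, h⟩ else y.2 ⟨j, h⟩ with hnv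
  have hsplit : ∀ {E : Type} [AddCommMonoid E] (g : ι → (Fin 3 → ℤ) → E) y x,
      ∑ j, g j (nv y x j) = ∑ j : {j // j ∈ B}, g j (x.2 j) + ∑ j : {j // j ∉ B}, g j (y.2 j) := by
    intro E _ g y x
    have e₁ : ∑ j : {j // j ∈ B}, g j (x.2 j) = ∑ j : {j // j ∈ B}, g j (nv y x j) :=
      Finset.sum_congr rfl fun j _ => by simp [hnv, j.2]
    have e₂ : ∑ j : {j // j ∉ B}, g j (y.2 j) = ∑ j : {j // j ∉ B}, g j (nv y x j) :=
      Finset.sum_congr rfl fun j _ => by simp [hnv, j.2]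
    rw [e₁, e₂]
    convert (Fintype.sum_subtype_add_sum_subtype (fun j => j ∈ B) fun j => g j (nv y x j)).symm
  have hsum : ∀ y x, ∑ j, nv y x j = ∑ j, x.2 j + ∑ j, y.2 j := hsplit fun _ n => n
  have hphase : ∀ y x, ∑ j, τ j * jbb α (nv y x j) =
      (∑ j, τ j.1 * jbb α (x.2 j)) + ∑ j, τ j.1 * jbb α (y.2 j) :=
    hsplit fun j n => τ j * jbb α n
  refine schur_test
    (fun y x => ind (y.1 = (∑ j, nv y x j) + x.1) *
            (∏ j, ind (SimFreq (Nv j) (nv y x j)) * ind (znorm (nv y x j) ≤ N)) *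
            (ind (SimFreq Nk x.1) * ind (znorm x.1 ≤ N)) *
            ind (|σ * jbb α ((∑ j, nv y x j) + x.1) + (∑ j, τ j * jbb α (nv y x j)) +
              σk * jbb α x.1 - ζ| ≤ 1) *
            (jb y.1 ^ (s - α + ε') / ((∏ j, jbb α (nv y x j)) * jb x.1 ^ s)))
    (fun y x => ind (y.1 = (∑ j, nv y x j) + x.1) * P y x)
    (fun y x => ind (y.1 = (∑ j, nv y x j) + x.1) * Q y x)
    (zball Nk ×ˢ Fintype.piFinset (fun j : {j : ι // j ∈ B} => zball (Nv j)))
    ((((Fintype.piFinset fun j => zball (Nv j)) ×ˢ zball Nk).image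
        fun z : (ι → Fin 3 → ℤ) × (Fin 3 → ℤ) => ∑ j, z.1 j + z.2) ×ˢ
      Fintype.piFinset (fun j : {j : ι // j ∉ B} => zball (Nv j)))
    ?_ (fun y x => mul_nonneg (ind_nonneg _) (hP y x))
    (fun y x => mul_nonneg (ind_nonneg _) (hQ y x)) ?_ hA hD ?_ ?_ ?_ f hf
  · intro y x hK
    simp only [mul_ne_zero_iff, Finset.prod_ne_zero_iff] at hK
    have hx1 : x.1 ∈ zball Nk :=
      mem_zball.mpr ((ind_ne_zero hK.1.1.2.1).znorm_le hNk)
    have hv : ∀ j, nv y x j ∈ zball (Nv j) := fun j =>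
      mem_zball.mpr ((ind_ne_zero (hK.1.1.1.2 j (Finset.mem_univ j)).1).znorm_le (hNv j))
    refine ⟨Finset.mem_product.mpr ⟨hx1, Fintype.mem_piFinset.mpr fun j => ?_⟩,
      Finset.mem_product.mpr ⟨Finset.mem_image.mpr ⟨(nv y x, x.1), ?_, ?_⟩,
        Fintype.mem_piFinset.mpr fun j => ?_⟩⟩
    · simpa [hnv, j.2] using hv j
    · exact Finset.mem_product.mpr ⟨Fintype.mem_piFinset.mpr hv, hx1⟩
    · exact (ind_ne_zero hK.1.1.1.1).symm
    · simpa [hnv, j.2] using hv j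
  · refine mul_nonneg (Finset.prod_nonneg fun j _ => ?_) ?_
    · have := hNv j
      positivity
    · positivity
  · intro y x
    refine (kernel_sq_le hα hα' hη hη1 hs hs' hNk hNv _ _ _ _ _).trans ?_
    refine mul_le_mul_of_nonneg_left ?_ ?_
    · by_cases hp : y.1 = (∑ j, nv y x j) + x.1
      · rw [ind_of_true hp, one_mul, one_mul, one_mul, ← hp, hphase]
        exact hPQ y x
      · simp [ind_of_false hp]
    · refine mul_nonneg (Finset.prod_nonneg fun j _ => ?_) ?_
      · have := hNv j
        positivity
      · positivity
  · intro y
    have h := sum_prod_ind_mul_le (zball Nk)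
      (Fintype.piFinset (fun j : {j : ι // j ∈ B} => zball (Nv j)))
      (fun a v => y.1 = (∑ j, nv y (a, v) j) + a) (fun v => -(∑ j, v j + (∑ j, y.2 j - y.1)))
      (fun a v h => by
        have h' : y.1 = (∑ j, nv y (a, v) j) + a := h
        rw [h', hsum]
        abel)
      (fun a v => P y (a, v)) fun a v => hP y (a, v)
    exact h.trans (hrow y)
  · intro x
    have h := sum_prod_ind_mul_le (((Fintype.piFinset fun j => zball (Nv j)) ×ˢ zball Nk).image
        fun z : (ι → Fin 3 → ℤ) × (Fin 3 → ℤ) => ∑ j, z.1 j + z.2)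
      (Fintype.piFinset (fun j : {j : ι // j ∉ B} => zball (Nv j)))
      (fun a v => a = (∑ j, nv (a, v) x j) + x.1) (fun v => ∑ j, v j + (∑ j, x.2 j + x.1))
      (fun a v h => by
        have h' : a = (∑ j, nv (a, v) x j) + x.1 := h
        rw [h', hsum]
        abel)
      (fun a v => Q (a, v) x) fun a v => hQ (a, v) x
    exact h.trans (hcol x)

lemma tensor_sum_sq_le {ι : Type*} [Fintype ι] [DecidableEq ι] {α s ε' η N Nk : ℝ}
    (hα : 1 ≤ α) (hα' : α ≤ 3 / 2) (hη : 0 ≤ η) (hγ1 : 3 - 2 * α + η ≤ 1)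
    (hs : 3 - 2 * α + 2 * η ≤ 2 * s)
    (hs' : 2 * (s - α + ε') ≤ -(3 - 2 * α + η)) (hNk : 1 ≤ Nk)
    {Nv : ι → ℝ} (hNv : ∀ j, 1 ≤ Nv j) {σ σk : ℝ} (hσ : IsSign σ) (hσk : IsSign σk) (ζ : ℝ)
    {τ : ι → ℝ} (hτ : ∀ j, IsSign (τ j)) (B : Finset ι) {j₁ j₂ : ι} (hj : j₁ ≠ j₂)
    (hNj : Nv j₂ ≤ Nv j₁)
    (f : (Fin 3 → ℤ) × ({j : ι // j ∈ B} → Fin 3 → ℤ) → ℝ) (hf : ∑' x, f x ^ 2 = 1) :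
    (∑' y : (Fin 3 → ℤ) × ({j : ι // j ∉ B} → Fin 3 → ℤ),
      (∑' x : (Fin 3 → ℤ) × ({j : ι // j ∈ B} → Fin 3 → ℤ),
        (fun nv : ι → Fin 3 → ℤ =>
          ind (y.1 = (∑ j, nv j) + x.1) *
            (∏ j, ind (SimFreq (Nv j) (nv j)) * ind (znorm (nv j) ≤ N)) *
            (ind (SimFreq Nk x.1) * ind (znorm x.1 ≤ N)) *
            ind (|σ * jbb α ((∑ j, nv j) + x.1) + (∑ j, τ j * jbb α (nv j)) +
              σk * jbb α x.1 - ζ| ≤ 1) *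
            (jb y.1 ^ (s - α + ε') / ((∏ j, jbb α (nv j)) * jb x.1 ^ s)) * f x)
        (fun j => if h : j ∈ B then x.2 ⟨j, h⟩ else y.2 ⟨j, h⟩)) ^ 2) ≤
      (∏ j, 64 * Nv j ^ (-(2 * α))) * (2 * Nk ^ (-η)) *
        (10 ^ 12 * (∏ j, 27 * Nv j ^ 3) *
          (Nv j₁ ^ (-(3 - 2 * α + η)) * Nv j₂ ^ (-(3 - 2 * α + η)))) := by
  classical
  have hγ : 0 ≤ 3 - 2 * α + η := by linarith
  have hη1 : η ≤ 1 := by linarith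
  have schur := @tensor_schur ι _ _ α s ε' η N Nk hα hα' hη hη1 hs hs' hNk Nv hNv σ σk ζ τ B
  set γ := 3 - 2 * α + η
  have hpos : ∀ j, 0 < Nv j := fun j => lt_of_lt_of_le one_pos (hNv j)
  have hg : ∀ j, 0 ≤ Nv j ^ (-γ) := fun j => Real.rpow_nonneg (hpos j).le _
  have hL : 0 ≤ (∏ j, 64 * Nv j ^ (-(2 * α))) * (2 * Nk ^ (-η)) := by
    refine mul_nonneg (Finset.prod_nonneg fun j _ => ?_) ?_
    · have := hNv j
      positivity
    · positivity
  set R₁ : ℝ := ∏ j : {j // j ∈ B}, 27 * Nv j ^ 3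
  set R₂ : ℝ := ∏ j : {j // j ∉ B}, 27 * Nv j ^ 3
  have hR : ∏ j, 27 * Nv j ^ 3 = R₁ * R₂ := by
    convert (Fintype.prod_subtype_mul_prod_subtype (fun j => j ∈ B) fun j => 27 * Nv j ^ 3).symm
  have hR₁0 : 0 ≤ R₁ := Finset.prod_nonneg fun j _ => by
    have := hpos j
    positivity
  have hR₂0 : 0 ≤ R₂ := Finset.prod_nonneg fun j _ => by
    have := hpos j
    positivity
  have hjb1 : ∀ n, jb n ^ (-γ) ≤ 1 := fun n =>
    Real.rpow_le_one_of_one_le_of_nonpos (one_le_jb n) (by linarith)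
  have hjb0 : ∀ n, 0 ≤ jb n ^ (-γ) := fun n => Real.rpow_nonneg (jb_nonneg n) _
  have hc₁ : ∑ v ∈ Fintype.piFinset (fun j : {j : ι // j ∈ B} => zball (Nv j)), (1 : ℝ) ≤ R₁ := by
    rw [Finset.sum_const, nsmul_eq_mul, mul_one]
    exact card_piFinset_zball_le (N := fun j : {j : ι // j ∈ B} => Nv j) fun j => hNv j
  have hc₂ : ∑ v ∈ Fintype.piFinset (fun j : {j : ι // j ∉ B} => zball (Nv j)), (1 : ℝ) ≤ R₂ := by
    rw [Finset.sum_const, nsmul_eq_mul, mul_one]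
    exact card_piFinset_zball_le (N := fun j : {j : ι // j ∉ B} => Nv j) fun j => hNv j
  have hw₁ : ∀ i (_ : i ∈ B) b,
      ∑ v ∈ Fintype.piFinset (fun j : {j : ι // j ∈ B} => zball (Nv j)),
        jb (-(∑ j, v j + b)) ^ (-γ) ≤ 28800 * R₁ * Nv i ^ (-γ) := fun i hi b => by
    simp only [jb_neg]
    exact multi_sum_jb_rpow_le hγ hγ1 (N := fun j : {j : ι // j ∈ B} => Nv j)
      (fun j => hNv j) b ⟨i, hi⟩
  have hw₂ : ∀ i (_ : i ∉ B) b,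
      ∑ v ∈ Fintype.piFinset (fun j : {j : ι // j ∉ B} => zball (Nv j)),
        jb (∑ j, v j + b) ^ (-γ) ≤ 28800 * R₂ * Nv i ^ (-γ) := fun i hi b =>
    multi_sum_jb_rpow_le hγ hγ1 (N := fun j : {j : ι // j ∉ B} => Nv j)
      (fun j => hNv j) b ⟨i, hi⟩
  have mixed : ∀ i₁ i₂ (_ : i₁ ∈ B) (_ : i₂ ∉ B), 28800 * R₁ * Nv i₁ ^ (-γ) *
      (28800 * R₂ * Nv i₂ ^ (-γ)) ≤ 10 ^ 12 * (R₁ * R₂) * (Nv i₁ ^ (-γ) * Nv i₂ ^ (-γ)) := by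
    intro i₁ i₂ _ _
    have : 0 ≤ R₁ * R₂ * (Nv i₁ ^ (-γ) * Nv i₂ ^ (-γ)) :=
      mul_nonneg (mul_nonneg hR₁0 hR₂0) (mul_nonneg (hg _) (hg _))
    nlinarith
  have schur_mixed := fun i₁ i₂ (h₁ : i₁ ∈ B) (h₂ : i₂ ∉ B) =>
    schur (fun _ x => jb x.1 ^ (-γ)) (fun y _ => jb y.1 ^ (-γ)) (fun _ x => hjb0 _)
      (fun y _ => hjb0 _) (fun y x => by
        rw [mul_assoc, mul_comm (jb x.1 ^ (-γ))]
        exact mul_le_of_le_one_left (mul_nonneg (hjb0 _) (hjb0 _)) (ind_le_one _))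
      (mul_nonneg (mul_nonneg (by norm_num) hR₁0) (hg i₁))
      (mul_nonneg (mul_nonneg (by norm_num) hR₂0) (hg i₂))
      (fun y => hw₁ i₁ h₁ _) (fun x => hw₂ i₂ h₂ _) f hf
  have hX : 0 ≤ Nv j₁ ^ (-γ) * Nv j₂ ^ (-γ) := mul_nonneg (hg _) (hg _)
  have hRX : 0 ≤ R₁ * R₂ * (Nv j₁ ^ (-γ) * Nv j₂ ^ (-γ)) :=
    mul_nonneg (mul_nonneg hR₁0 hR₂0) hX
  rw [hR]
  by_cases h₁ : j₁ ∈ B <;> by_cases h₂ : j₂ ∈ B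
  · refine (schur (fun y x => ind (|σ * jbb α y.1 + ((∑ j, τ j.1 * jbb α (x.2 j)) +
        ∑ j, τ j.1 * jbb α (y.2 j)) + σk * jbb α x.1 - ζ| ≤ 1) * jb x.1 ^ (-γ)) (fun _ _ => 1)
      (fun y x => mul_nonneg (ind_nonneg _) (hjb0 _)) (fun _ _ => zero_le_one) (fun y x => ?_)
      (A := 4160000 * 28827 * R₁ * (Nv j₁ ^ (-γ) * Nv j₂ ^ (-γ))) (D := R₂)
      (mul_nonneg (mul_nonneg (by norm_num) hR₁0) hX) hR₂0 (fun y => ?_) (fun x => hc₂) f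
      hf).trans (mul_le_mul_of_nonneg_left (by nlinarith) hL)
    · rw [mul_one]
      refine mul_le_mul_of_nonneg_right ?_ (hjb0 _)
      exact mul_le_of_le_one_right (ind_nonneg _) (hjb1 _)
    · refine le_trans (le_of_eq ?_) (multi_sum_phase_le hα hα' hγ hγ1 hσk
        (τ := fun j : {j : ι // j ∈ B} => τ j) (fun j => hτ j)
        (N := fun j : {j : ι // j ∈ B} => Nv j) (fun j => hNv j) (∑ j, y.2 j - y.1)
        (ζ - σ * jbb α y.1 - ∑ j, τ j.1 * jbb α (y.2 j))
        (j₁ := ⟨j₁, h₁⟩) (j₂ := ⟨j₂, h₂⟩) (fun h => hj (congrArg Subtype.val h)) hNj)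
      refine Finset.sum_congr rfl fun v _ => ?_
      simp only [jb_neg, jbb_neg]
      congr 4
      ring
  · refine (schur_mixed j₁ j₂ h₁ h₂).trans
      (mul_le_mul_of_nonneg_left (mixed j₁ j₂ h₁ h₂) hL)
  · refine (schur_mixed j₂ j₁ h₂ h₁).trans (mul_le_mul_of_nonneg_left ?_ hL)
    rw [mul_comm (Nv j₁ ^ (-γ))]
    exact mixed j₂ j₁ h₂ h₁
  · refine (schur (fun _ _ => 1) (fun y x => ind (|σ * jbb α y.1 + ((∑ j, τ j.1 * jbb α (x.2 j)) +
        ∑ j, τ j.1 * jbb α (y.2 j)) + σk * jbb α x.1 - ζ| ≤ 1) * jb y.1 ^ (-γ))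
      (fun _ _ => zero_le_one) (fun y x => mul_nonneg (ind_nonneg _) (hjb0 _)) (fun y x => ?_)
      (A := R₁) (D := 4160000 * 28827 * R₂ * (Nv j₁ ^ (-γ) * Nv j₂ ^ (-γ)))
      hR₁0 (mul_nonneg (mul_nonneg (by norm_num) hR₂0) hX) (fun y => hc₁) (fun x => ?_) f
      hf).trans (mul_le_mul_of_nonneg_left (by nlinarith) hL)
    · rw [one_mul]
      exact mul_le_of_le_one_right (mul_nonneg (ind_nonneg _) (hjb0 _)) (hjb1 _)
    · refine le_trans (le_of_eq ?_) (multi_sum_phase_le hα hα' hγ hγ1 hσ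
        (τ := fun j : {j : ι // j ∉ B} => τ j) (fun j => hτ j)
        (N := fun j : {j : ι // j ∉ B} => Nv j) (fun j => hNv j) (∑ j, x.2 j + x.1)
        (ζ - σk * jbb α x.1 - ∑ j, τ j.1 * jbb α (x.2 j))
        (j₁ := ⟨j₁, h₁⟩) (j₂ := ⟨j₂, h₂⟩) (fun h => hj (congrArg Subtype.val h)) hNj)
      refine Finset.sum_congr rfl fun v _ => ?_
      congr 4
      ring

lemma exists_exponent_gain {α s : ℝ} (hα : 1 < α) (hα' : α ≤ 3 / 2)
    (hs₁ : -α + 3 / 2 < s) (hs₂ : s < 2 * α - 3 / 2) :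
    ∃ η ε₀ : ℝ, 0 < η ∧ 0 < ε₀ ∧ 4 * ε₀ ≤ η ∧ 3 - 2 * α + η ≤ 1 ∧ 3 - 2 * α + 2 * η ≤ 2 * s ∧
      (∀ ε' < ε₀, 2 * (s - α + ε') ≤ -(3 - 2 * α + η)) ∧
      (α < 3 / 2 → 2 * ε₀ ≤ 3 - 2 * α) := by
  set η := min (α - 1) (min ((2 * s - (3 - 2 * α)) / 2) ((4 * α - 3 - 2 * s) / 2)) with hη
  have h1 : η ≤ α - 1 := min_le_left _ _
  have h2 : η ≤ (2 * s - (3 - 2 * α)) / 2 := (min_le_right _ _).trans (min_le_left _ _)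
  have h3 : η ≤ (4 * α - 3 - 2 * s) / 2 := (min_le_right _ _).trans (min_le_right _ _)
  have h0 : 0 < η := lt_min (by linarith) (lt_min (by linarith) (by linarith))
  rcases hα'.lt_or_eq with h | h
  · have e1 : min (η / 4) ((3 - 2 * α) / 2) ≤ η / 4 := min_le_left _ _
    have e2 : min (η / 4) ((3 - 2 * α) / 2) ≤ (3 - 2 * α) / 2 := min_le_right _ _
    exact ⟨η, min (η / 4) ((3 - 2 * α) / 2), h0, lt_min (by linarith) (by linarith),
      by linarith, by linarith, by linarith, fun ε' he => by linarith, fun _ => by linarith⟩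
  · exact ⟨η, η / 4, h0, by linarith, by linarith, by linarith, by linarith,
      fun ε' he => by linarith, fun h' => absurd h h'.ne⟩

/-- **Deterministic tensor estimate** (Lemma 3.12), stated with `k = m + 1` (so `k ≥ 3`
↔ `m ≥ 2`); the variables `n₁, …, n_{k−1}` are indexed by `Fin m` and `n_k` is kept
separate.  Under the stated assumptions on `α, s, ε, ε'` there exist `δ > 0` and
`C > 0` such that for every `ζ`, all dyadic `N, N₁, …, N_k ≥ 1` with `N_j ≤ N`, and
every partition `(B₁, B₂)` of `{1, …, k−1}` (modelled by a finset `B` and its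
complement), the `ℓ²(n_k, (n_j)_{j∈B₁}) → ℓ²(n, (n_j)_{j∈B₂})` operator norm of the
tensor `h^ζ` is at most `C · N^{(k−3)(3/2−α)−ε} · (max_j N_j)^{−δ}`; the operator-norm
bound is expressed by testing against all unit `ℓ²` input vectors `f`. -/
theorem deterministic_tensor_estimate (m : ℕ) (hm : 2 ≤ m) (α s : ℝ)
    (hα : 1 < α) (hs₁ : max (-α + 3 / 2) (α - 1) < s) (hs₂ : s < 2 * α - 3 / 2) :
    ∃ ε₀ : ℝ, 0 < ε₀ ∧
      ∀ ε ε' : ℝ,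
        ((m + 1 = 3 ∧ α ≤ 3 / 2 ∧ ε = 0) ∨
          (3 < m + 1 ∧ α < 3 / 2 ∧ 0 < ε ∧ ε < ε₀)) →
        0 < ε' → ε' < ε₀ →
        ∃ δ C : ℝ, 0 < δ ∧ 0 < C ∧
          ∀ εsum εk : ℝ, IsSign εsum → IsSign εk →
          ∀ εv : Fin m → ℝ, (∀ j, IsSign (εv j)) →
          ∀ ζ : ℝ, ∀ N Nk : ℝ, IsDyadic N → IsDyadic Nk → Nk ≤ N →
          ∀ Nv : Fin m → ℝ, (∀ j, IsDyadic (Nv j)) → (∀ j, Nv j ≤ N) →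
          ∀ B : Finset (Fin m),
          ∀ f : (Fin 3 → ℤ) × ({j : Fin m // j ∈ B} → Fin 3 → ℤ) → ℝ,
            (∑' x, f x ^ 2) = 1 →
            (∑' y : (Fin 3 → ℤ) × ({j : Fin m // j ∉ B} → Fin 3 → ℤ),
                (∑' x : (Fin 3 → ℤ) × ({j : Fin m // j ∈ B} → Fin 3 → ℤ),
                    (fun nv : Fin m → Fin 3 → ℤ =>
                        ind (y.1 = (∑ j, nv j) + x.1) *
                          (∏ j, ind (SimFreq (Nv j) (nv j)) * ind (znorm (nv j) ≤ N)) *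
                          (ind (SimFreq Nk x.1) * ind (znorm x.1 ≤ N)) *
                          ind (|εsum * jbb α ((∑ j, nv j) + x.1) +
                                (∑ j, εv j * jbb α (nv j)) + εk * jbb α x.1 - ζ| ≤ 1) *
                          (jb y.1 ^ (s - α + ε') /
                            ((∏ j, jbb α (nv j)) * jb x.1 ^ s)) * f x)
                      (fun j => if h : j ∈ B then x.2 ⟨j, h⟩ else y.2 ⟨j, h⟩)) ^ 2)
              ≤ (C * N ^ (((m : ℝ) - 2) * (3 / 2 - α) - ε) *
                  (max Nk (sSup (Set.range Nv))) ^ (-δ)) ^ 2 := by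
  have hs₁' : -α + 3 / 2 < s := (le_max_left _ _).trans_lt hs₁
  by_cases hα' : α ≤ 3 / 2
  swap
  · refine ⟨1, one_pos, fun ε ε' h => ?_⟩
    rcases h with h | h <;> exact absurd (by linarith [h.2.1]) hα'
  obtain ⟨η, ε₀, hη, hε₀, hηε, hγ1, hs, hs', hβ⟩ := exists_exponent_gain hα hα' hs₁' hs₂
  refine ⟨ε₀, hε₀, fun ε ε' hε hε'0 hε' => ?_⟩
  have hεη : 2 * ε < η := by
    rcases hε with h | h
    · linarith [h.2.2]
    · linarith [h.2.2.2]
  have hexp : 0 ≤ ((m : ℝ) - 2) * (3 - 2 * α) - 2 * ε := by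
    rcases hε with ⟨h, _, h'⟩ | ⟨h, h1, _, h2⟩
    · have : (m : ℝ) = 2 := by exact_mod_cast (by omega : m = 2)
      rw [this, h']
      norm_num
    · have h3 : (3 : ℝ) ≤ m := by exact_mod_cast (by omega : 3 ≤ m)
      have := hβ h1
      nlinarith
  refine ⟨(η - 2 * ε) / 2, 2 * 10 ^ 12 * 1728 ^ m, by linarith, by positivity, ?_⟩
  intro εsum εk hσ hσk εv hτ ζ N Nk hN hNk hNkN Nv hNv hNvN B f hf
  have : Nonempty (Fin m) := ⟨⟨0, by omega⟩⟩
  have : Nontrivial (Fin m) := Fin.nontrivial_iff_two_le.mpr hm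
  obtain ⟨j₁, hj₁⟩ := Finite.exists_max Nv
  obtain ⟨j₂, hj⟩ := exists_ne j₁
  have hsup : sSup (Set.range Nv) = Nv j₁ :=
    IsGreatest.csSup_eq ⟨Set.mem_range_self j₁, by rintro _ ⟨j, rfl⟩; exact hj₁ j⟩
  rw [hsup]
  set M := max Nk (Nv j₁) with hM
  have hNv1 : ∀ j, 1 ≤ Nv j := fun j => (hNv j).one_le
  have hpos : ∀ j, 0 < Nv j := fun j => lt_of_lt_of_le one_pos (hNv1 j)
  have hM1 : 1 ≤ M := hNk.one_le.trans (le_max_left _ _)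
  have hM0 : 0 < M := by linarith
  have hMN : M ≤ N := max_le hNkN (hNvN j₁)
  have hN0 : 0 < N := hM0.trans_le hMN
  have hmax : M ≤ Nv j₁ ∨ M ≤ Nk := by
    rcases le_total Nk (Nv j₁) with h | h
    · exact Or.inl (max_le h le_rfl)
    · exact Or.inr (max_le le_rfl h)
  refine (tensor_sum_sq_le hα.le hα' hη.le hγ1 hs (hs' ε' hε') hNk.one_le hNv1 hσ hσk ζ hτ B
    hj.symm (hj₁ j₂) f hf).trans ?_
  have hprod : (∏ j, 64 * Nv j ^ (-(2 * α))) * ∏ j, 27 * Nv j ^ 3 =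
      1728 ^ m * ∏ j, Nv j ^ (3 - 2 * α) := by
    have e : ∀ j, 64 * Nv j ^ (-(2 * α)) * (27 * Nv j ^ 3) = 1728 * Nv j ^ (3 - 2 * α) := by
      intro j
      rw [sub_eq_add_neg, Real.rpow_add (hpos j)]
      norm_cast
      ring
    rw [← Finset.prod_mul_distrib, Finset.prod_congr rfl fun j _ => e j, Finset.prod_mul_distrib]
    simp
  have hfreq := freq_prod_le (β := 3 - 2 * α) (η := η) (by linarith) hη.le hNk.one_le hNv1
    (fun j => (hj₁ j).trans (le_max_right Nk _)) hj.symm hmax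
  rw [Fintype.card_fin] at hfreq
  have hC : (1 : ℝ) ≤ 2 * 10 ^ 12 * 1728 ^ m := by
    have : (1 : ℝ) ≤ 1728 ^ m := one_le_pow₀ (by norm_num)
    linarith
  have hMpow : M ^ (((m : ℝ) - 2) * (3 - 2 * α) - η) ≤
      (N ^ (((m : ℝ) - 2) * (3 / 2 - α) - ε) * M ^ (-((η - 2 * ε) / 2))) ^ 2 := by
    have e1 : (N ^ (((m : ℝ) - 2) * (3 / 2 - α) - ε)) ^ 2 =
        N ^ (((m : ℝ) - 2) * (3 - 2 * α) - 2 * ε) := by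
      rw [← Real.rpow_natCast, ← Real.rpow_mul hN0.le]
      push_cast
      ring_nf
    have e2 : (M ^ (-((η - 2 * ε) / 2))) ^ 2 = M ^ (2 * ε - η) := by
      rw [← Real.rpow_natCast, ← Real.rpow_mul hM0.le]
      push_cast
      ring_nf
    rw [mul_pow, e1, e2]
    calc M ^ (((m : ℝ) - 2) * (3 - 2 * α) - η)
        = M ^ (((m : ℝ) - 2) * (3 - 2 * α) - 2 * ε) * M ^ (2 * ε - η) := by
          rw [← Real.rpow_add hM0]
          ring_nf
      _ ≤ _ := by
          gcongr
  calc _ = (2 * 10 ^ 12) * ((∏ j, 64 * Nv j ^ (-(2 * α))) * ∏ j, 27 * Nv j ^ 3) * (Nk ^ (-η) *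
        (Nv j₁ ^ (-(3 - 2 * α + η)) * Nv j₂ ^ (-(3 - 2 * α + η)))) := by ring
    _ = 2 * 10 ^ 12 * 1728 ^ m * ((∏ j, Nv j ^ (3 - 2 * α)) * Nk ^ (-η) *
        (Nv j₁ ^ (-(3 - 2 * α + η)) * Nv j₂ ^ (-(3 - 2 * α + η)))) := by
        rw [hprod]
        ring
    _ ≤ (2 * 10 ^ 12 * 1728 ^ m) ^ 2 *
        (N ^ (((m : ℝ) - 2) * (3 / 2 - α) - ε) * M ^ (-((η - 2 * ε) / 2))) ^ 2 :=
        mul_le_mul (le_self_pow₀ hC two_ne_zero) (hfreq.trans hMpow)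
          (mul_nonneg (mul_nonneg (Finset.prod_nonneg fun j _ => Real.rpow_nonneg (hpos j).le _)
            (Real.rpow_nonneg (by linarith [hNk.one_le]) _))
            (mul_nonneg (Real.rpow_nonneg (hpos _).le _) (Real.rpow_nonneg (hpos _).le _)))
          (by positivity)
    _ = _ := by ring
end
end

section
/- Multilinear discrete convolution estimate (Lemma 2.4(ii)): Let d ≥ 1 and k ≥ 1 be integers and let β ∈ ℝ satisfy (k−1)d/k < β < d. Then there exists a constant C > 0 such that for every n ∈ ℤ^d, Σ_{n_1 + ⋯ + n_k = n, n_j ∈ ℤ^d} ⟨n_1⟩^{−β} ⋯ ⟨n_k⟩^{−β} ≤ C · ⟨n⟩^{(k−1)d − kβ}. -/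
noncomputable section

open scoped BigOperators

/-- Japanese bracket `⟨n⟩ = (1 + |n|²)^{1/2}` of a lattice point in `ℤ^d`. -/
def jbd {d : ℕ} (n : Fin d → ℤ) : ℝ := Real.sqrt (1 + ∑ i, ((n i : ℝ)) ^ 2)

open scoped ENNReal

lemma one_le_jbd {d : ℕ} (n : Fin d → ℤ) : 1 ≤ jbd n := by
  unfold jbd
  rw [Real.one_le_sqrt]
  have : 0 ≤ ∑ i, ((n i : ℝ)) ^ 2 := Finset.sum_nonneg fun i _ => sq_nonneg _
  linarith

lemma jbd_pos {d : ℕ} (n : Fin d → ℤ) : 0 < jbd n := one_pos.trans_le (one_le_jbd n)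

lemma abs_le_jbd {d : ℕ} (n : Fin d → ℤ) (i : Fin d) : |(n i : ℝ)| ≤ jbd n := by
  unfold jbd
  apply Real.abs_le_sqrt
  have := Finset.single_le_sum (f := fun i => ((n i : ℝ)) ^ 2)
    (fun i _ => sq_nonneg _) (Finset.mem_univ i)
  linarith

lemma jbd_add_le {d : ℕ} (m n : Fin d → ℤ) : jbd (m + n) ≤ jbd m + jbd n := by
  have hm := jbd_pos m
  have hn := jbd_pos n
  have hm2 : jbd m ^ 2 = 1 + ∑ i, ((m i : ℝ)) ^ 2 :=
    Real.sq_sqrt (add_nonneg zero_le_one (Finset.sum_nonneg fun i _ => sq_nonneg _))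
  have hn2 : jbd n ^ 2 = 1 + ∑ i, ((n i : ℝ)) ^ 2 :=
    Real.sq_sqrt (add_nonneg zero_le_one (Finset.sum_nonneg fun i _ => sq_nonneg _))
  have hcs : ∑ i, (m i : ℝ) * n i ≤ jbd m * jbd n := by
    apply (Real.sum_mul_le_sqrt_mul_sqrt _ _ _).trans
    unfold jbd
    gcongr <;> linarith
  have hexp : ∑ i, (((m + n) i : ℤ) : ℝ) ^ 2
      = ∑ i, ((m i : ℝ)) ^ 2 + 2 * ∑ i, (m i : ℝ) * n i + ∑ i, ((n i : ℝ)) ^ 2 := by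
    rw [Finset.mul_sum, ← Finset.sum_add_distrib, ← Finset.sum_add_distrib]
    refine Finset.sum_congr rfl fun i _ => ?_
    simp only [Pi.add_apply, Int.cast_add]
    ring
  conv_lhs => unfold jbd
  apply Real.sqrt_le_iff.2 ⟨by positivity, ?_⟩
  rw [hexp]
  nlinarith

/-- The number of lattice points with bracket at most `R` is `O(R^d)`. -/
lemma tsum_ite_jbd_le (d : ℕ) {R : ℝ} (hR : 0 < R) :
    (∑' m : Fin d → ℤ, if jbd m ≤ R then (1 : ℝ≥0∞) else 0)
      ≤ ENNReal.ofReal ((3 * R) ^ (d : ℝ)) := by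
  by_cases h1 : R < 1
  · have : ∀ m : Fin d → ℤ, ¬ jbd m ≤ R := fun m h => by linarith [one_le_jbd m]
    simp [this]
  push Not at h1
  have hfl : (0 : ℤ) ≤ ⌊R⌋ := Int.floor_nonneg.2 hR.le
  let s : Finset (Fin d → ℤ) := Fintype.piFinset fun _ => Finset.Icc (-⌊R⌋) ⌊R⌋
  have hs : ∀ m ∉ s, (if jbd m ≤ R then (1 : ℝ≥0∞) else 0) = 0 := by
    intro m hm
    rw [if_neg]
    intro h
    apply hm
    simp only [s, Fintype.mem_piFinset, Finset.mem_Icc]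
    intro i
    have := (abs_le.1 ((abs_le_jbd m i).trans h))
    constructor
    · rw [neg_le]
      apply Int.le_floor.2
      push_cast
      linarith
    · exact Int.le_floor.2 this.2
  rw [tsum_eq_sum hs]
  calc (∑ m ∈ s, if jbd m ≤ R then (1 : ℝ≥0∞) else 0) ≤ ∑ m ∈ s, 1 :=
        Finset.sum_le_sum fun m _ => by split_ifs <;> simp
    _ = (s.card : ℝ≥0∞) := by simp
    _ = ENNReal.ofReal s.card := (ENNReal.ofReal_natCast _).symm
    _ ≤ _ := by
        apply ENNReal.ofReal_le_ofReal
        rw [Real.rpow_natCast]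
        simp only [s, Fintype.card_piFinset, Int.card_Icc, Finset.prod_const, Finset.card_univ,
          Fintype.card_fin, Nat.cast_pow]
        gcongr
        have : (((⌊R⌋ + 1 - -⌊R⌋).toNat : ℤ) : ℝ) = ((⌊R⌋ + 1 - -⌊R⌋ : ℤ) : ℝ) := by
          rw [Int.toNat_of_nonneg (by linarith)]
        rw [Int.cast_natCast] at this
        rw [this]
        push_cast
        linarith [Int.floor_le R]

/-- The weight `⟨m⟩^{-s}` as an extended nonnegative real. -/
def jbdWeight {d : ℕ} (s : ℝ) (m : Fin d → ℤ) : ℝ≥0∞ := ENNReal.ofReal (jbd m ^ (-s))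

/-- Summation over shells of geometrically growing or shrinking radii. -/
lemma tsum_geometric_shells_le (d : ℕ) {q s : ℝ} (hq : 0 < q) (hqs : q ^ (d - s) < 1) :
    ∃ C : ℝ≥0∞, C ≠ ∞ ∧ ∀ R : ℝ, 0 < R → ∀ f : (Fin d → ℤ) → ℝ≥0∞,
      (∀ m, f m ≠ 0 → ∃ j : ℕ, jbd m ≤ 2 * (R * q ^ j) ∧
        f m ≤ ENNReal.ofReal ((R * q ^ j) ^ (-s))) →
      ∑' m, f m ≤ C * ENNReal.ofReal (R ^ (d - s)) := by
  have hq0 : 0 ≤ q ^ (d - s) := Real.rpow_nonneg hq.le _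
  refine ⟨ENNReal.ofReal (6 ^ (d : ℝ)) * ∑' j : ℕ, ENNReal.ofReal (q ^ (d - s)) ^ j, ?_, ?_⟩
  · apply ENNReal.mul_ne_top ENNReal.ofReal_ne_top
    rw [ENNReal.tsum_geometric]
    apply ENNReal.inv_ne_top.2
    rw [Ne, tsub_eq_zero_iff_le, not_le]
    exact ENNReal.ofReal_lt_one.2 hqs
  intro R hR f hf
  have hRq : ∀ j : ℕ, 0 < R * q ^ j := fun j => by positivity
  calc ∑' m, f m
      ≤ ∑' m : Fin d → ℤ, ∑' j : ℕ, (if jbd m ≤ 2 * (R * q ^ j) then (1 : ℝ≥0∞) else 0)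
          * ENNReal.ofReal ((R * q ^ j) ^ (-s)) := by
        apply ENNReal.tsum_le_tsum
        intro m
        by_cases hm : f m = 0
        · rw [hm]; exact zero_le
        obtain ⟨j, hj, hfj⟩ := hf m hm
        refine le_trans ?_ (ENNReal.le_tsum j)
        rwa [if_pos hj, one_mul]
    _ = ∑' j : ℕ, (∑' m : Fin d → ℤ, if jbd m ≤ 2 * (R * q ^ j) then (1 : ℝ≥0∞) else 0)
          * ENNReal.ofReal ((R * q ^ j) ^ (-s)) := by
        rw [ENNReal.tsum_comm]
        simp_rw [ENNReal.tsum_mul_right]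
    _ ≤ ∑' j : ℕ, ENNReal.ofReal (6 ^ (d : ℝ)) * ENNReal.ofReal (q ^ (d - s)) ^ j
          * ENNReal.ofReal (R ^ (d - s)) := by
        apply ENNReal.tsum_le_tsum
        intro j
        have h2 : 0 < 2 * (R * q ^ j) := mul_pos two_pos (hRq j)
        refine (mul_le_mul_left (tsum_ite_jbd_le d h2) _).trans (le_of_eq ?_)
        rw [← ENNReal.ofReal_pow hq0, ← ENNReal.ofReal_mul (by positivity),
          ← ENNReal.ofReal_mul (by positivity), ← ENNReal.ofReal_mul (by positivity)]
        congr 1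
        have e1 : 3 * (2 * (R * q ^ j)) = 6 * (R * q ^ j) := by ring
        rw [e1, Real.mul_rpow (by norm_num) (hRq j).le, mul_assoc, ← Real.rpow_add (hRq j),
          ← sub_eq_add_neg, Real.mul_rpow hR.le (by positivity), ← Real.rpow_natCast q j,
          ← Real.rpow_mul hq.le, mul_comm (j : ℝ), Real.rpow_mul hq.le, Real.rpow_natCast _ j]
        ring
    _ = _ := by rw [ENNReal.tsum_mul_right, ENNReal.tsum_mul_left]

lemma tsum_jbdWeight_inside_le (d : ℕ) {s : ℝ} (hs : 0 < s) (hsd : s < d) :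
    ∃ C : ℝ≥0∞, C ≠ ∞ ∧ ∀ R : ℝ, 0 < R →
      (∑' m : Fin d → ℤ, if jbd m ≤ R then jbdWeight s m else 0)
        ≤ C * ENNReal.ofReal (R ^ (d - s)) := by
  obtain ⟨C, hC, h⟩ := tsum_geometric_shells_le d (q := 1 / 2) (s := s) (by norm_num)
    (Real.rpow_lt_one (by norm_num) (by norm_num) (sub_pos.2 hsd))
  refine ⟨C, hC, fun R hR => (h (R / 2) (by positivity) _ ?_).trans ?_⟩
  · intro m hm
    have hmR : jbd m ≤ R := by
      by_contra hcon
      exact hm (if_neg hcon)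
    have hmp := jbd_pos m
    obtain ⟨j, hj1, hj2⟩ := exists_nat_pow_near ((one_le_div hmp).2 hmR) one_lt_two
    rw [le_div_iff₀ hmp] at hj1
    rw [div_lt_iff₀ hmp, pow_succ] at hj2
    have h2 : (0 : ℝ) < 2 ^ j := by positivity
    have e : R / 2 * (1 / 2) ^ j = R / 2 / 2 ^ j := by rw [one_div, inv_pow]; rfl
    refine ⟨j, ?_, ?_⟩ <;> rw [e]
    · rw [← mul_div_assoc, le_div_iff₀ h2]
      linarith
    · rw [if_pos hmR]
      apply ENNReal.ofReal_le_ofReal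
      apply Real.rpow_le_rpow_of_nonpos (by positivity) _ (by linarith)
      rw [div_le_iff₀ h2]
      linarith
  · gcongr
    linarith

lemma tsum_jbdWeight_outside_le (d : ℕ) {s : ℝ} (hsd : d < s) :
    ∃ C : ℝ≥0∞, C ≠ ∞ ∧ ∀ R : ℝ, 0 < R →
      (∑' m : Fin d → ℤ, if R ≤ jbd m then jbdWeight s m else 0)
        ≤ C * ENNReal.ofReal (R ^ (d - s)) := by
  have hs : 0 < s := lt_of_le_of_lt d.cast_nonneg hsd
  obtain ⟨C, hC, h⟩ := tsum_geometric_shells_le d (q := 2) (s := s) (by norm_num)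
    (Real.rpow_lt_one_of_one_lt_of_neg (by norm_num) (sub_neg.2 hsd))
  refine ⟨C, hC, fun R hR => h R hR _ ?_⟩
  intro m hm
  have hmR : R ≤ jbd m := by
    by_contra hcon
    exact hm (if_neg hcon)
  obtain ⟨j, hj1, hj2⟩ := exists_nat_pow_near ((one_le_div hR).2 hmR) one_lt_two
  rw [le_div_iff₀ hR] at hj1
  rw [div_lt_iff₀ hR, pow_succ] at hj2
  refine ⟨j, by linarith, ?_⟩
  rw [if_pos hmR]
  apply ENNReal.ofReal_le_ofReal
  apply Real.rpow_le_rpow_of_nonpos (by positivity) _ (by linarith)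
  linarith

lemma jbdWeight_mul_le {d : ℕ} {a b : ℝ} (ha : 0 < a) (hb : 0 < b) (n m : Fin d → ℤ) :
    jbdWeight a m * jbdWeight b (n - m) ≤
      (if jbd m ≤ jbd n / 2 then jbdWeight a m else 0) * ENNReal.ofReal ((jbd n / 2) ^ (-b))
      + (if jbd (n - m) ≤ jbd n / 2 then jbdWeight b (n - m) else 0)
        * ENNReal.ofReal ((jbd n / 2) ^ (-a))
      + (if jbd n / 2 ≤ jbd m then jbdWeight (a + b) m else 0)
      + (if jbd n / 2 ≤ jbd (n - m) then jbdWeight (a + b) (n - m) else 0) := by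
  have htri : jbd n ≤ jbd m + jbd (n - m) := by simpa using jbd_add_le m (n - m)
  have hN : 0 < jbd n / 2 := half_pos (jbd_pos n)
  have hmono : ∀ {s x y : ℝ}, 0 < s → 0 < x → x ≤ y →
      ENNReal.ofReal (y ^ (-s)) ≤ ENNReal.ofReal (x ^ (-s)) := fun hs hx hxy =>
    ENNReal.ofReal_le_ofReal (Real.rpow_le_rpow_of_nonpos hx hxy (by linarith))
  have hadd : ∀ l : Fin d → ℤ, jbdWeight a l * jbdWeight b l = jbdWeight (a + b) l := by
    intro l
    have := jbd_pos l
    unfold jbdWeight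
    rw [← ENNReal.ofReal_mul (by positivity), ← Real.rpow_add this, neg_add]
  by_cases h1 : jbd m ≤ jbd n / 2
  · rw [if_pos h1]
    refine le_add_right (le_add_right (le_add_right ?_))
    gcongr
    exact hmono hb hN (by linarith)
  by_cases h2 : jbd (n - m) ≤ jbd n / 2
  · rw [if_pos h2]
    refine le_add_right (le_add_right (le_add_left ?_))
    rw [mul_comm]
    gcongr
    exact hmono ha hN (by linarith)
  rw [if_pos (not_le.1 h1).le, if_pos (not_le.1 h2).le]
  rcases le_total (jbd m) (jbd (n - m)) with h | h
  · refine le_add_right (le_add_left ?_)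
    rw [← hadd]
    gcongr
    exact hmono hb (jbd_pos m) h
  · refine le_add_left ?_
    rw [← hadd]
    gcongr
    exact hmono ha (jbd_pos _) h

/-- The bilinear discrete convolution estimate. -/
lemma tsum_jbdWeight_mul_le (d : ℕ) {a b : ℝ} (ha : 0 < a) (had : a < d) (hb : 0 < b)
    (hbd : b < d) (hab : d < a + b) :
    ∃ C : ℝ≥0∞, C ≠ ∞ ∧ ∀ n : Fin d → ℤ,
      ∑' m, jbdWeight a m * jbdWeight b (n - m) ≤ C * jbdWeight (a + b - d) n := by
  obtain ⟨A, hA, hA'⟩ := tsum_jbdWeight_inside_le d ha had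
  obtain ⟨B, hB, hB'⟩ := tsum_jbdWeight_inside_le d hb hbd
  obtain ⟨D, hD, hD'⟩ := tsum_jbdWeight_outside_le d hab
  refine ⟨(A + B + D + D) * ENNReal.ofReal ((1 / 2) ^ (d - (a + b))), by finiteness, fun n => ?_⟩
  have hn := jbd_pos n
  have hN : 0 < jbd n / 2 := half_pos hn
  have hrefl : ∀ f : (Fin d → ℤ) → ℝ≥0∞, ∑' m, f (n - m) = ∑' m, f m := fun f =>
    (Equiv.subLeft n).tsum_eq f
  have hpow : ∀ {x y : ℝ}, x + y = d - (a + b) →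
      ENNReal.ofReal ((jbd n / 2) ^ x) * ENNReal.ofReal ((jbd n / 2) ^ y)
        = ENNReal.ofReal ((jbd n / 2) ^ (d - (a + b))) := by
    intro x y h
    rw [← ENNReal.ofReal_mul (by positivity), ← Real.rpow_add hN, h]
  calc _ ≤ _ := ENNReal.tsum_le_tsum (jbdWeight_mul_le ha hb n)
    _ = (∑' m : Fin d → ℤ, if jbd m ≤ jbd n / 2 then jbdWeight a m else 0)
          * ENNReal.ofReal ((jbd n / 2) ^ (-b))
        + (∑' m : Fin d → ℤ, if jbd m ≤ jbd n / 2 then jbdWeight b m else 0)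
          * ENNReal.ofReal ((jbd n / 2) ^ (-a))
        + (∑' m : Fin d → ℤ, if jbd n / 2 ≤ jbd m then jbdWeight (a + b) m else 0)
        + (∑' m : Fin d → ℤ, if jbd n / 2 ≤ jbd m then jbdWeight (a + b) m else 0) := by
      rw [ENNReal.tsum_add, ENNReal.tsum_add, ENNReal.tsum_add, ENNReal.tsum_mul_right,
        ENNReal.tsum_mul_right,
        hrefl fun m => if jbd m ≤ jbd n / 2 then jbdWeight b m else 0,
        hrefl fun m => if jbd n / 2 ≤ jbd m then jbdWeight (a + b) m else 0]
    _ ≤ A * ENNReal.ofReal ((jbd n / 2) ^ (d - a)) * ENNReal.ofReal ((jbd n / 2) ^ (-b))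
        + B * ENNReal.ofReal ((jbd n / 2) ^ (d - b)) * ENNReal.ofReal ((jbd n / 2) ^ (-a))
        + D * ENNReal.ofReal ((jbd n / 2) ^ (d - (a + b)))
        + D * ENNReal.ofReal ((jbd n / 2) ^ (d - (a + b))) := by
      gcongr
      · exact hA' _ hN
      · exact hB' _ hN
      · exact hD' _ hN
      · exact hD' _ hN
    _ = (A + B + D + D) * ENNReal.ofReal ((jbd n / 2) ^ (d - (a + b))) := by
      rw [mul_assoc, mul_assoc, hpow (by ring), hpow (by ring)]
      ring
    _ = _ := by
      unfold jbdWeight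
      rw [mul_assoc, ← ENNReal.ofReal_mul (by positivity), neg_sub, div_eq_mul_one_div (jbd n),
        Real.mul_rpow hn.le (by norm_num), mul_comm (jbd n ^ _)]

/-- The multilinear estimate with values in `[0, ∞]`. -/
lemma tsum_prod_jbdWeight_le (d : ℕ) {β : ℝ} (hβ : 0 < β) (hβd : β < d) {k : ℕ} (hk : 1 ≤ k)
    (h : ((k : ℝ) - 1) * d < k * β) :
    ∃ C : ℝ≥0∞, C ≠ ∞ ∧ ∀ n : Fin d → ℤ,
      (∑' nv : Fin k → Fin d → ℤ, if ∑ j, nv j = n then ∏ j, jbdWeight β (nv j) else 0)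
        ≤ C * jbdWeight (k * β - (k - 1) * d) n := by
  induction k, hk using Nat.le_induction with
  | base =>
    refine ⟨1, ENNReal.one_ne_top, fun n => ?_⟩
    rw [← (Equiv.funUnique (Fin 1) (Fin d → ℤ)).symm.tsum_eq]
    simp
  | succ k hk ih =>
    push_cast at h ⊢
    have hk' : ((k : ℝ) - 1) * d < k * β := by linarith
    have hk1 : (1 : ℝ) ≤ k := by exact_mod_cast hk
    obtain ⟨C, hC, hC'⟩ := ih hk'
    obtain ⟨D, hD, hD'⟩ := tsum_jbdWeight_mul_le d (a := β) (b := k * β - (k - 1) * d) hβ hβd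
      (by linarith) (by nlinarith) (by linarith)
    refine ⟨C * D, ENNReal.mul_ne_top hC hD, fun n => ?_⟩
    rw [← (Fin.consEquiv fun _ => Fin d → ℤ).tsum_eq, ENNReal.tsum_prod']
    calc _ = ∑' m, jbdWeight β m * ∑' nv : Fin k → Fin d → ℤ,
            if ∑ j, nv j = n - m then ∏ j, jbdWeight β (nv j) else 0 := by
          refine tsum_congr fun m => ?_
          rw [← ENNReal.tsum_mul_left]
          refine tsum_congr fun nv => ?_
          simp [Fin.consEquiv, Fin.sum_univ_succ, Fin.prod_univ_succ, eq_sub_iff_add_eq']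
      _ ≤ ∑' m, jbdWeight β m * (C * jbdWeight (k * β - (k - 1) * d) (n - m)) :=
          ENNReal.tsum_le_tsum fun m => by gcongr; exact hC' _
      _ = C * ∑' m, jbdWeight β m * jbdWeight (k * β - (k - 1) * d) (n - m) := by
          rw [← ENNReal.tsum_mul_left]
          exact tsum_congr fun m => by ring
      _ ≤ C * (D * jbdWeight (β + (k * β - (k - 1) * d) - d) n) := by gcongr; exact hD' n
      _ = _ := by
          rw [mul_assoc]
          congr 3
          ring

/-- **Multilinear discrete convolution estimate** (Lemma 2.4(ii)): for `d, k ≥ 1` and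
`(k−1)d/k < β < d` there is `C > 0` so that for all `n ∈ ℤ^d`,
`Σ_{n₁+⋯+n_k=n} ⟨n₁⟩^{−β} ⋯ ⟨n_k⟩^{−β}` converges and is at most
`C · ⟨n⟩^{(k−1)d − kβ}`. -/
theorem discrete_convolution_multilinear (d k : ℕ) (hd : 1 ≤ d) (hk : 1 ≤ k) (β : ℝ)
    (h₁ : ((k : ℝ) - 1) * d / k < β) (h₂ : β < d) :
    ∃ C : ℝ, 0 < C ∧
      ∀ n : Fin d → ℤ,
        Summable (fun nv : Fin k → Fin d → ℤ =>
          ind ((∑ j, nv j) = n) * ∏ j, jbd (nv j) ^ (-β)) ∧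
        (∑' nv : Fin k → Fin d → ℤ,
            ind ((∑ j, nv j) = n) * ∏ j, jbd (nv j) ^ (-β))
          ≤ C * jbd n ^ (((k : ℝ) - 1) * d - k * β) := by
  have hk0 : (0 : ℝ) < k := by exact_mod_cast hk
  have hk1 : (1 : ℝ) ≤ k := by exact_mod_cast hk
  have hβ : 0 < β := lt_of_le_of_lt
    (div_nonneg (mul_nonneg (sub_nonneg.2 hk1) d.cast_nonneg) hk0.le) h₁
  rw [div_lt_iff₀ hk0, mul_comm β] at h₁
  obtain ⟨C, hC, hC'⟩ := tsum_prod_jbdWeight_le d hβ h₂ hk h₁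
  refine ⟨C.toReal + 1, by positivity, fun n => ?_⟩
  have hn := jbd_pos n
  set f : (Fin k → Fin d → ℤ) → ℝ := fun nv => ind ((∑ j, nv j) = n) * ∏ j, jbd (nv j) ^ (-β)
    with hf
  have hf0 : ∀ nv, 0 ≤ f nv := fun nv => mul_nonneg (by unfold ind; split_ifs <;> norm_num)
    (Finset.prod_nonneg fun j _ => Real.rpow_nonneg (jbd_pos _).le _)
  have hfe : ∀ nv, ENNReal.ofReal (f nv)
      = if ∑ j, nv j = n then ∏ j, jbdWeight β (nv j) else 0 := by
    intro nv
    unfold jbdWeight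
    rw [← ENNReal.ofReal_prod_of_nonneg fun j _ => Real.rpow_nonneg (jbd_pos _).le _]
    simp only [hf, ind]
    split_ifs <;> simp
  have hle : ∑' nv, ENNReal.ofReal (f nv)
      ≤ ENNReal.ofReal (C.toReal * jbd n ^ (((k : ℝ) - 1) * d - k * β)) := by
    simp_rw [hfe]
    refine (hC' n).trans (le_of_eq ?_)
    rw [ENNReal.ofReal_mul ENNReal.toReal_nonneg, ENNReal.ofReal_toReal hC, jbdWeight, neg_sub]
  have hsum : Summable f := by
    have := ENNReal.summable_toReal (ne_top_of_le_ne_top ENNReal.ofReal_ne_top hle)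
    simpa only [ENNReal.toReal_ofReal (hf0 _)] using this
  refine ⟨hsum, ?_⟩
  rw [← ENNReal.ofReal_tsum_of_nonneg hf0 hsum,
    ENNReal.ofReal_le_ofReal_iff (by positivity)] at hle
  refine hle.trans ?_
  gcongr
  linarith
end
end
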